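/- arXiv:1211.0812 — 2 statements merged into one kernel-verified Lean document; each statement's English description precedes it below -/
import Mathlib

section
/- Let E be a Banach lattice and let A and B be bounded linear operators on E such that AB ≥ BA ≥ 0 (i.e., BA is a positive operator and the commutator C = AB − BA is a positive operator), and such that AB is a power-compact operator. Then the commutator C = AB − BA is ideal-triangularizable: there exists a chain of closed ideals of E, each invariant under C, which is a maximal chain in the lattice of all closed ideals of E. -/
/-- A closed ideal of a Banach lattice: a topologically closed linear subspace that is solid. -/
def IsClosedIdeal {E : Type*} [NormedAddCommGroup E] [Lattice E] [HasSolidNorm E] [IsOrderedAddMonoid E] [NormedSpace ℝ E]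
    (I : Submodule ℝ E) : Prop :=
  IsClosed (I : Set E) ∧ ∀ x y : E, |x| ≤ |y| → y ∈ I → x ∈ I

/-- A subspace `I` is invariant under an operator `T` if `T` maps `I` into `I`. -/
def InvariantUnder {E : Type*} [NormedAddCommGroup E] [Lattice E] [HasSolidNorm E] [IsOrderedAddMonoid E] [NormedSpace ℝ E]
    (T : E →L[ℝ] E) (I : Submodule ℝ E) : Prop :=
  ∀ x ∈ I, T x ∈ I

set_option linter.unusedSectionVars false

namespace BanachLattice

open Filter Topology

section Basic

variable {E : Type*} [NormedAddCommGroup E] [Lattice E] [HasSolidNorm E] [IsOrderedAddMonoid E]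
  [NormedSpace ℝ E]

theorem smul_nonneg_of_nonneg {c : ℝ} (hc : 0 ≤ c) {x : E} (hx : 0 ≤ x) : 0 ≤ c • x := by
  have dyadic : ∀ (n : ℕ) (y : E), 0 ≤ (2 ^ n : ℕ) • y → 0 ≤ y := by
    intro n
    induction n with
    | zero => intro y hy; simpa using hy
    | succ n ih =>
      intro y hy
      refine ih y (nsmul_two_semiclosed ?_)
      rwa [← mul_nsmul, ← pow_succ]
  have hlim : Tendsto (fun n : ℕ => ((⌊c * (2 : ℝ) ^ n⌋₊ : ℝ) / (2 : ℝ) ^ n) • x) atTop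
      (𝓝 (c • x)) := by
    refine Tendsto.smul_const ?_ x
    exact (tendsto_nat_floor_mul_div_atTop hc).comp
      (tendsto_pow_atTop_atTop_of_one_lt (one_lt_two : (1 : ℝ) < 2))
  refine ge_of_tendsto' hlim fun n => dyadic n _ ?_
  rw [← Nat.cast_smul_eq_nsmul ℝ, smul_smul, Nat.cast_pow, Nat.cast_two,
    mul_div_cancel₀ _ (by positivity), Nat.cast_smul_eq_nsmul]
  exact nsmul_nonneg hx _

instance instIsOrderedModule : IsOrderedModule ℝ E where
  smul_le_smul_of_nonneg_left c hc x y hxy := by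
    have := smul_nonneg_of_nonneg hc (sub_nonneg.2 hxy)
    rwa [smul_sub, sub_nonneg] at this
  smul_le_smul_of_nonneg_right x hx c d hcd := by
    have := smul_nonneg_of_nonneg (sub_nonneg.2 hcd) hx
    rwa [sub_smul, sub_nonneg] at this

theorem abs_smul_le (c : ℝ) (x : E) : |c • x| ≤ |c| • |x| := by
  have h1 : ∀ d : ℝ, d • x ≤ |d| • |x| := fun d => by
    rcases le_total 0 d with hd | hd
    · rw [abs_of_nonneg hd]
      exact smul_le_smul_of_nonneg_left (le_abs_self x) hd
    · rw [abs_of_nonpos hd, ← neg_smul_neg]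
      exact smul_le_smul_of_nonneg_left (neg_le_abs x) (neg_nonneg.2 hd)
  rw [abs_le']
  refine ⟨h1 c, ?_⟩
  simpa using h1 (-c)

theorem eq_zero_of_abs_eq_zero {x : E} (h : |x| = 0) : x = 0 := by
  rw [← norm_eq_zero, ← norm_abs_eq_norm, h, norm_zero]

theorem eq_zero_of_abs_nonpos {x : E} (h : |x| ≤ 0) : x = 0 :=
  eq_zero_of_abs_eq_zero (le_antisymm h (abs_nonneg x))

/-- An operator is positive if it maps the positive cone into itself. -/
def IsPos (T : E →L[ℝ] E) : Prop := ∀ x : E, 0 ≤ x → 0 ≤ T x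

variable {S T U : E →L[ℝ] E}

theorem IsPos.mono (hT : IsPos T) {x y : E} (h : x ≤ y) : T x ≤ T y := by
  simpa using hT _ (sub_nonneg.2 h)

theorem IsPos.abs_apply_le (hT : IsPos T) (x : E) : |T x| ≤ T |x| := by
  rw [abs_le']
  refine ⟨hT.mono (le_abs_self x), ?_⟩
  rw [← map_neg]
  exact hT.mono (neg_le_abs x)

theorem IsPos.mul (hS : IsPos S) (hT : IsPos T) : IsPos (S * T) := fun x hx => hS _ (hT x hx)

theorem IsPos.add (hS : IsPos S) (hT : IsPos T) : IsPos (S + T) := fun x hx =>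
  add_nonneg (hS x hx) (hT x hx)

theorem IsPos.smul {c : ℝ} (hc : 0 ≤ c) (hT : IsPos T) : IsPos (c • T) := fun x hx =>
  smul_nonneg hc (hT x hx)

theorem isPos_one : IsPos (1 : E →L[ℝ] E) := fun _ hx => hx

theorem IsPos.pow (hT : IsPos T) (n : ℕ) : IsPos (T ^ n) := by
  induction n with
  | zero => simpa using isPos_one
  | succ n ih => rw [pow_succ]; exact ih.mul hT

theorem norm_le_norm_of_nonneg {x y : E} (hx : 0 ≤ x) (h : x ≤ y) : ‖x‖ ≤ ‖y‖ :=
  norm_le_norm_of_abs_le_abs (by rwa [abs_of_nonneg hx, abs_of_nonneg (hx.trans h)])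

theorem IsPos.norm_le (hS : IsPos S) (h : IsPos (T - S)) : ‖S‖ ≤ ‖T‖ := by
  refine S.opNorm_le_bound (norm_nonneg _) fun x => ?_
  have h1 : ‖S x‖ ≤ ‖T |x|‖ := by
    rw [← norm_abs_eq_norm (S x)]
    refine norm_le_norm_of_nonneg (abs_nonneg _) ((hS.abs_apply_le x).trans ?_)
    simpa using h _ (abs_nonneg x)
  refine h1.trans ((T.le_opNorm _).trans_eq ?_)
  rw [norm_abs_eq_norm]

/-- Truncation of `x` to the order interval `[-b, b]`. -/
theorem abs_truncate_le {b : E} (hb : 0 ≤ b) (x : E) : |(x ⊓ b) ⊔ (-b)| ≤ b := by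
  rw [abs_le']
  refine ⟨sup_le inf_le_right ((neg_nonpos.2 hb).trans hb), ?_⟩
  rw [neg_le]
  exact le_sup_right

theorem truncate_eq_self {b x : E} (h : |x| ≤ b) : (x ⊓ b) ⊔ (-b) = x := by
  have := abs_le'.1 h
  rw [inf_eq_left.2 this.1, sup_eq_left]
  exact neg_le.1 this.2

theorem abs_sub_truncate_le {b c x : E} (hc : 0 ≤ c) (h : |x| ≤ b + c) :
    |x - ((x ⊓ b) ⊔ (-b))| ≤ c := by
  have := abs_le'.1 h
  have h1 : x ≤ b + c := this.1
  have h2 : -(b + c) ≤ x := neg_le.1 this.2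
  rw [abs_le']
  constructor
  · rw [sub_le_comm]
    refine le_sup_of_le_left (le_inf (sub_le_self _ hc) ?_)
    rwa [sub_le_iff_le_add]
  · rw [neg_sub, sub_le_iff_le_add]
    refine sup_le (inf_le_left.trans (le_add_of_nonneg_left hc)) ?_
    rw [← sub_le_iff_le_add']
    rwa [neg_add, ← sub_eq_add_neg] at h2

/-- The solid subspace of elements dominated by a member of a sequence of positive elements that
absorbs sums and multiples. -/
def dominated (s : ℕ → E) (hs : ∀ m, 0 ≤ s m)
    (hadd : ∀ m n, ∃ k, s m + s n ≤ s k) : Submodule ℝ E where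
  carrier := {x | ∃ m, |x| ≤ s m}
  zero_mem' := ⟨0, by simpa using hs 0⟩
  add_mem' := by
    rintro x y ⟨m, hm⟩ ⟨n, hn⟩
    obtain ⟨k, hk⟩ := hadd m n
    exact ⟨k, (abs_add_le x y).trans ((add_le_add hm hn).trans hk)⟩
  smul_mem' := by
    rintro c x ⟨m, hm⟩
    have hmul : ∀ j : ℕ, ∃ k, j • s m ≤ s k := by
      intro j
      induction j with
      | zero => exact ⟨m, by simpa using hs m⟩
      | succ j ih =>
        obtain ⟨k, hk⟩ := ih
        obtain ⟨l, hl⟩ := hadd k m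
        exact ⟨l, by rw [succ_nsmul]; exact (add_le_add_left hk _).trans hl⟩
    obtain ⟨k, hk⟩ := hmul ⌈|c|⌉₊
    refine ⟨k, le_trans ?_ hk⟩
    rw [← Nat.cast_smul_eq_nsmul ℝ]
    refine (abs_smul_le c x).trans ?_
    exact _root_.smul_le_smul (Nat.le_ceil _) hm (abs_nonneg c) ((abs_nonneg x).trans hm)

/-- The closure of a solid subspace is a closed ideal. -/
theorem isClosedIdeal_topologicalClosure {I : Submodule ℝ E}
    (hI : ∀ x y : E, |x| ≤ |y| → y ∈ I → x ∈ I) : IsClosedIdeal I.topologicalClosure := by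
  refine ⟨I.isClosed_topologicalClosure, fun x y hxy hy => ?_⟩
  rw [← SetLike.mem_coe, Submodule.topologicalClosure_coe] at hy ⊢
  have hcont : Continuous fun z : E => (x ⊓ |z|) ⊔ (-|z|) := by
    have : Continuous fun z : E => |z| := continuous_id.sup continuous_neg
    fun_prop
  have := map_mem_closure hcont hy (t := (I : Set E)) fun z hz =>
    hI _ z (by simpa using abs_truncate_le (abs_nonneg z) x) hz
  rwa [truncate_eq_self hxy] at this

theorem _root_.IsClosedIdeal.abs_mem {I : Submodule ℝ E} (hI : IsClosedIdeal I) {x : E}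
    (hx : x ∈ I) :
    |x| ∈ I := hI.2 _ x (by rw [abs_abs]) hx

/-- The null ideal of a positive operator. -/
def nullIdeal (V : E →L[ℝ] E) (hV : IsPos V) : Submodule ℝ E where
  carrier := {x | V |x| = 0}
  zero_mem' := by simp
  add_mem' := by
    intro x y hx hy
    refine le_antisymm ?_ (hV _ (abs_nonneg _))
    have := hV.mono (abs_add_le x y)
    rwa [map_add, show V |x| = 0 from hx, show V |y| = 0 from hy, add_zero] at this
  smul_mem' := by
    intro c x hx
    refine le_antisymm ?_ (hV _ (abs_nonneg _))
    have := hV.mono (abs_smul_le c x)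
    rwa [map_smul, show V |x| = 0 from hx, smul_zero] at this

theorem mem_nullIdeal {V : E →L[ℝ] E} {hV : IsPos V} {x : E} :
    x ∈ nullIdeal V hV ↔ V |x| = 0 := Iff.rfl

theorem isClosedIdeal_nullIdeal {V : E →L[ℝ] E} (hV : IsPos V) :
    IsClosedIdeal (nullIdeal V hV) := by
  refine ⟨?_, fun x y hxy hy => ?_⟩
  · have : Continuous fun z : E => V |z| :=
      V.continuous.comp (continuous_id.sup continuous_neg)
    exact isClosed_singleton.preimage this
  · rw [mem_nullIdeal] at hy ⊢
    exact le_antisymm (hy ▸ hV.mono hxy) (hV _ (abs_nonneg _))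

end Basic

section Resolvent

variable {E : Type*} [NormedAddCommGroup E] [Lattice E] [HasSolidNorm E] [IsOrderedAddMonoid E]
  [NormedSpace ℝ E] [CompleteSpace E] {T : E →L[ℝ] E}

/-- `U` is a positive inverse of `t - T`. -/
structure IsPosResolvent (T : E →L[ℝ] E) (t : ℝ) (U : E →L[ℝ] E) : Prop where
  isPos : IsPos U
  sub_mul : (t • 1 - T) * U = 1
  mul_sub : U * (t • 1 - T) = 1

theorem exists_pos_inverse_one_sub {V : E →L[ℝ] E} (hV : IsPos V) (h : ‖V‖ < 1) :
    ∃ W : E →L[ℝ] E, IsPos W ∧ (1 - V) * W = 1 ∧ W * (1 - V) = 1 := by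
  have hs : HasSum (fun n : ℕ => V ^ n) (∑' n : ℕ, V ^ n) :=
    (summable_geometric_of_norm_lt_one h).hasSum
  refine ⟨∑' n : ℕ, V ^ n, fun x hx => ?_, mul_neg_geom_series V h, geom_series_mul_neg V h⟩
  have h2 := hs.mapL (ContinuousLinearMap.apply ℝ E x)
  exact h2.nonneg fun n => hV.pow n x hx

theorem IsPosResolvent.exists_of_le {t s : ℝ} {U : E →L[ℝ] E} (hU : IsPosResolvent T t U)
    (hst : s ≤ t) (h : (t - s) * ‖U‖ < 1) : ∃ U', IsPosResolvent T s U' := by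
  have hV : IsPos ((t - s) • U) := hU.isPos.smul (sub_nonneg.2 hst)
  obtain ⟨W, hW, h1, h2⟩ := exists_pos_inverse_one_sub hV (by
    rwa [norm_smul, Real.norm_of_nonneg (sub_nonneg.2 hst)])
  have e1 : s • 1 - T = (t • 1 - T) * (1 - (t - s) • U) := by
    rw [_root_.mul_sub, mul_one, mul_smul_comm, hU.sub_mul, sub_smul]; abel
  have e2 : s • 1 - T = (1 - (t - s) • U) * (t • 1 - T) := by
    rw [_root_.sub_mul, one_mul, smul_mul_assoc, hU.mul_sub, sub_smul]; abel
  have hr : (s • 1 - T) * (U * W) = 1 := by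
    rw [e2, mul_assoc, ← mul_assoc (t • 1 - T), hU.sub_mul, one_mul, h1]
  have hl : (W * U) * (s • 1 - T) = 1 := by
    rw [e1, mul_assoc, ← mul_assoc U, hU.mul_sub, one_mul, h2]
  exact ⟨U * W, hU.isPos.mul hW, hr, left_inv_eq_right_inv hl hr ▸ hl⟩

theorem exists_isPosResolvent (hT : IsPos T) : ∃ t > 0, ∃ U, IsPosResolvent T t U := by
  have hpos : (0 : ℝ) < ‖T‖ + 1 := by positivity
  obtain ⟨W, hW, h1, h2⟩ := exists_pos_inverse_one_sub (hT.smul (inv_nonneg.2 hpos.le)) (by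
    rw [norm_smul, Real.norm_of_nonneg (inv_nonneg.2 hpos.le), inv_mul_lt_one₀ hpos]
    linarith)
  have e : (‖T‖ + 1) • 1 - T = (‖T‖ + 1) • (1 - (‖T‖ + 1)⁻¹ • T) := by
    rw [smul_sub, smul_smul, mul_inv_cancel₀ hpos.ne', one_smul]
  refine ⟨‖T‖ + 1, hpos, (‖T‖ + 1)⁻¹ • W, hW.smul (inv_nonneg.2 hpos.le), ?_, ?_⟩
  · rw [e, smul_mul_smul_comm, mul_inv_cancel₀ hpos.ne', h1, one_smul]
  · rw [e, smul_mul_smul_comm, inv_mul_cancel₀ hpos.ne', h2, one_smul]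

theorem IsPosResolvent.pow_le {t : ℝ} {U : E →L[ℝ] E} (hT : IsPos T) (ht : 0 < t)
    (hU : IsPosResolvent T t U) (k : ℕ) : IsPos (t ^ (k + 1) • U - T ^ k) := by
  have key : t • U = 1 + T * U := by
    have := hU.sub_mul
    rw [_root_.sub_mul, smul_mul_assoc, one_mul, sub_eq_iff_eq_add] at this
    exact this
  induction k with
  | zero =>
    rw [zero_add, pow_one, pow_zero, key, add_sub_cancel_left]
    exact hT.mul hU.isPos
  | succ k ih =>
    have : t ^ (k + 1 + 1) • U - T ^ (k + 1) = t ^ (k + 1) • 1 + T * (t ^ (k + 1) • U - T ^ k) := by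
      rw [pow_succ t (k + 1), mul_smul, key, smul_add, _root_.mul_sub, mul_smul_comm, pow_succ' T]
      abel
    rw [this]
    exact (isPos_one.smul (by positivity)).add (hT.mul ih)

/-- A sequence of positive resolvents with unbounded norms at points decreasing to a positive
number produces a positive eigenoperator. -/
theorem exists_eigenoperator_of_approx {N : ℕ}
    (hN : IsCompactOperator ⇑(T ^ N)) {lam : ℝ} (hlam : 0 < lam) (U : ℕ → E →L[ℝ] E)
    (hpos : ∀ n, IsPos (U n)) (hnorm : ∀ n, ‖U n‖ = 1) (hcomm : ∀ n, T * U n = U n * T)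
    (hlim : Tendsto (fun n => ‖T * U n - lam • U n‖) atTop (𝓝 0)) :
    ∃ V : E →L[ℝ] E, IsPos V ∧ V ≠ 0 ∧ T * V = lam • V ∧ V * T = lam • V := by
  have hpow : ∀ k : ℕ, Tendsto (fun n => T ^ k * U n - lam ^ k • U n) atTop (𝓝 0) := by
    intro k
    induction k with
    | zero => simp
    | succ k ih =>
      have h1 : ∀ n, T ^ (k + 1) * U n - lam ^ (k + 1) • U n =
          T * (T ^ k * U n - lam ^ k • U n) + lam ^ k • (T * U n - lam • U n) := by
        intro n
        rw [_root_.mul_sub, mul_smul_comm, smul_sub, smul_smul, pow_succ', pow_succ, mul_assoc]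
        abel
      simp_rw [h1]
      simpa using (ih.const_mul T).add
        ((tendsto_zero_iff_norm_tendsto_zero.2 hlim).const_smul (lam ^ k))
  have happ : ∀ (k : ℕ) (x : ℕ → E) (C : ℝ), (∀ n, ‖x n‖ ≤ C) →
      Tendsto (fun n => (T ^ k) (U n (x n)) - lam ^ k • U n (x n)) atTop (𝓝 0) := by
    intro k x C hx
    have h1 := (tendsto_zero_iff_norm_tendsto_zero.1 (hpow k)).mul_const C
    rw [zero_mul] at h1
    refine squeeze_zero_norm (fun n => ?_) h1
    refine le_trans ?_ (mul_le_mul_of_nonneg_left (hx n) (norm_nonneg _))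
    exact ContinuousLinearMap.le_opNorm (T ^ k * U n - lam ^ k • U n) (x n)
  let 𝒰 : Ultrafilter ℕ := hyperfilter ℕ
  have h𝒰 : (𝒰 : Filter ℕ) ≤ atTop := Nat.hyperfilter_le_atTop
  have hcpt : ∀ (x : ℕ → E) (C : ℝ), (∀ n, ‖x n‖ ≤ C) →
      ∃ y, Tendsto (fun n => (T ^ N) (x n)) 𝒰 (𝓝 y) := by
    intro x C hx
    obtain ⟨K, hK, hK'⟩ := hN.image_closedBall_subset_compact C
    obtain ⟨y, -, hy⟩ := hK.ultrafilter_le_nhds (𝒰.map fun n => (T ^ N) (x n)) (by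
      rw [le_principal_iff]
      exact mem_map.2 (univ_mem' fun n => hK' ⟨x n, by simpa using hx n, rfl⟩))
    exact ⟨y, hy⟩
  have hUle : ∀ n x, ‖U n x‖ ≤ ‖x‖ := fun n x => by
    simpa [hnorm n] using (U n).le_opNorm x
  have hex : ∀ x : E, ∃ y, Tendsto (fun n => U n x) 𝒰 (𝓝 y) := by
    intro x
    obtain ⟨y, hy⟩ := hcpt (fun n => U n x) ‖x‖ fun n => hUle n x
    have h1 := (hy.sub ((happ N (fun _ => x) ‖x‖ fun _ => le_rfl).mono_left h𝒰)).const_smul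
      ((lam ^ N)⁻¹)
    refine ⟨_, h1.congr fun n => ?_⟩
    rw [sub_sub_cancel, inv_smul_smul₀ (pow_pos hlam N).ne']
  choose v hv using hex
  let V₀ : E →ₗ[ℝ] E :=
    { toFun := v
      map_add' := fun x y => tendsto_nhds_unique (hv (x + y)) (by
        simpa using (hv x).add (hv y))
      map_smul' := fun c x => tendsto_nhds_unique (hv (c • x)) (by
        simpa using (hv x).const_smul c) }
  let V : E →L[ℝ] E := V₀.mkContinuous 1 fun x => by
    rw [one_mul]
    exact le_of_tendsto' (hv x).norm fun n => hUle n x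
  have hV : ∀ x, Tendsto (fun n => U n x) 𝒰 (𝓝 (V x)) := hv
  have hTV : T * V = lam • V := by
    ext x
    have h1 := (T.continuous.tendsto _).comp (hV x)
    have h2 := ((happ 1 (fun _ => x) ‖x‖ fun _ => le_rfl).mono_left h𝒰).add
      ((hV x).const_smul lam)
    refine tendsto_nhds_unique h1 ?_
    simpa [Function.comp_def] using h2
  refine ⟨V, fun x hx => ge_of_tendsto' (hV x) fun n => hpos n x hx, ?_, hTV, ?_⟩
  · have hx : ∀ n, ∃ x : E, ‖x‖ ≤ 1 ∧ 1 / 2 ≤ ‖U n x‖ := fun n => by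
      obtain ⟨x, hx, hx'⟩ := (U n).exists_lt_apply_of_lt_opNorm (r := 1 / 2)
        (by rw [hnorm n]; norm_num)
      exact ⟨x, hx.le, hx'.le⟩
    choose x hx1 hx2 using hx
    obtain ⟨y, hy⟩ := hcpt x 1 hx1
    intro hV0
    have h1 : Tendsto (fun n => U n y) 𝒰 (𝓝 0) := by simpa [hV0] using hV y
    have h2 : Tendsto (fun n => U n ((T ^ N) (x n) - y)) 𝒰 (𝓝 0) := by
      refine squeeze_zero_norm (fun n => hUle n _) ?_
      simpa using (hy.sub_const y).norm
    have hcomm' : ∀ n, (T ^ N) (U n (x n)) = U n ((T ^ N) (x n)) := fun n => by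
      have : Commute T (U n) := hcomm n
      exact congrArg (fun W : E →L[ℝ] E => W (x n)) (this.pow_left N)
    have h3 := (h2.add h1).sub ((happ N x 1 hx1).mono_left h𝒰)
    have h4 : Tendsto (fun n => lam ^ N • U n (x n)) 𝒰 (𝓝 0) := by
      simpa [hcomm'] using h3
    have h5 : lam ^ N * (1 / 2) ≤ 0 := by
      rw [← norm_zero (E := E)]
      refine ge_of_tendsto' h4.norm fun n => ?_
      rw [norm_smul, Real.norm_of_nonneg (by positivity)]
      exact mul_le_mul_of_nonneg_left (hx2 n) (by positivity)
    have : 0 < lam ^ N := by positivity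
    linarith
  · rw [← hTV]
    ext x
    have h1 := (T.continuous.tendsto _).comp (hV x)
    refine tendsto_nhds_unique (hV (T x)) (h1.congr fun n => ?_)
    exact congrArg (fun W : E →L[ℝ] E => W x) (hcomm n)

/-- Either the powers of a power-compact positive operator decay faster than every geometric
sequence, or the operator has a positive eigenoperator at some positive number. -/
theorem pow_decay_or_exists_eigenoperator (hT : IsPos T) {N : ℕ}
    (hN : IsCompactOperator ⇑(T ^ N)) :
    (∀ ε > 0, ∃ C : ℝ, ∀ k, ‖T ^ k‖ ≤ C * ε ^ k) ∨
    ∃ lam : ℝ, 0 < lam ∧ ∃ V : E →L[ℝ] E, IsPos V ∧ V ≠ 0 ∧ T * V = lam • V ∧ V * T = lam • V := by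
  set G : Set ℝ := {t | 0 < t ∧ ∃ U, IsPosResolvent T t U} with hG
  have hGne : G.Nonempty := by
    obtain ⟨t, ht, U, hU⟩ := exists_isPosResolvent hT
    exact ⟨t, ht, U, hU⟩
  have hGb : BddBelow G := ⟨0, fun t ht => ht.1.le⟩
  have hlam0 : 0 ≤ sInf G := Real.sInf_nonneg fun t ht => ht.1.le
  rcases hlam0.eq_or_lt with h0 | hlam
  · left
    intro ε hε
    obtain ⟨t, ⟨ht0, U, hU⟩, htε⟩ := exists_lt_of_csInf_lt hGne (h0 ▸ hε)
    refine ⟨t * ‖U‖, fun k => ?_⟩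
    have h1 := (hT.pow k).norm_le (hU.pow_le hT ht0 k)
    rw [norm_smul, Real.norm_of_nonneg (by positivity)] at h1
    have h2 : t ^ k ≤ ε ^ k := pow_le_pow_left₀ ht0.le htε.le k
    calc ‖T ^ k‖ ≤ t ^ (k + 1) * ‖U‖ := h1
      _ = t * ‖U‖ * t ^ k := by ring
      _ ≤ t * ‖U‖ * ε ^ k := by gcongr
  · right
    refine ⟨sInf G, hlam, ?_⟩
    set m := sInf G with hm
    obtain ⟨t, -, htlim, htG⟩ : ∃ t : ℕ → ℝ, Antitone t ∧ Tendsto t atTop (𝓝 m) ∧ ∀ n, t n ∈ G :=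
      exists_seq_tendsto_sInf hGne hGb
    choose ht0 W hW using htG
    have hge : ∀ n, m ≤ t n := fun n => csInf_le hGb ⟨ht0 n, W n, hW n⟩
    have hWnorm : ∀ n, 1 ≤ (t n - m) * ‖W n‖ := by
      intro n
      by_contra! hlt
      have hev : ∀ᶠ s in 𝓝[<] m, (t n - s) * ‖W n‖ < 1 := by
        refine nhdsWithin_le_nhds ((Continuous.tendsto (by fun_prop) m).eventually_lt_const hlt)
      have hev2 : ∀ᶠ s in 𝓝[<] m, 0 < s := nhdsWithin_le_nhds (lt_mem_nhds hlam)
      obtain ⟨s, ⟨hs1, hs2⟩, hs3⟩ := ((hev.and hev2).and self_mem_nhdsWithin).exists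
      have hs3' : s < m := hs3
      exact hs3'.not_ge (csInf_le hGb ⟨hs2, (hW n).exists_of_le (hs3'.le.trans (hge n)) hs1⟩)
    have hWpos : ∀ n, 0 < ‖W n‖ := fun n => by
      refine (norm_nonneg _).lt_of_ne fun h => ?_
      have := hWnorm n
      rw [← h, mul_zero] at this
      linarith
    have hTW : ∀ n, T * W n = t n • W n - 1 := fun n => by
      have := (hW n).sub_mul
      rw [_root_.sub_mul, smul_mul_assoc, one_mul] at this
      rw [← this, sub_sub_cancel]
    have hWT : ∀ n, W n * T = t n • W n - 1 := fun n => by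
      have := (hW n).mul_sub
      rw [_root_.mul_sub, mul_smul_comm, mul_one] at this
      rw [← this, sub_sub_cancel]
    refine exists_eigenoperator_of_approx hN hlam (fun n => ‖W n‖⁻¹ • W n)
      (fun n => (hW n).isPos.smul (inv_nonneg.2 (hWpos n).le))
      (fun n => by rw [norm_smul, norm_inv, norm_norm, inv_mul_cancel₀ (hWpos n).ne'])
      (fun n => by rw [mul_smul_comm, smul_mul_assoc, hTW, hWT]) ?_
    have hlim : Tendsto (fun n => (t n - m) + (t n - m) * ‖(1 : E →L[ℝ] E)‖) atTop (𝓝 0) := by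
      have h1 : Tendsto (fun n => t n - m) atTop (𝓝 0) := by simpa using htlim.sub_const m
      simpa using h1.add (h1.mul_const ‖(1 : E →L[ℝ] E)‖)
    refine squeeze_zero (fun n => norm_nonneg _) (fun n => ?_) hlim
    have e : T * (‖W n‖⁻¹ • W n) - m • (‖W n‖⁻¹ • W n) = ‖W n‖⁻¹ • ((t n - m) • W n - 1) := by
      rw [mul_smul_comm, hTW, smul_comm m, ← smul_sub, sub_smul]
      congr 1
      abel
    rw [e, norm_smul, norm_inv, norm_norm, inv_mul_le_iff₀ (hWpos n)]
    refine (norm_sub_le _ _).trans ?_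
    rw [norm_smul, Real.norm_of_nonneg (sub_nonneg.2 (hge n))]
    nlinarith [mul_le_mul_of_nonneg_right (hWnorm n) (norm_nonneg (1 : E →L[ℝ] E))]

end Resolvent

section Irreducible

variable {E : Type*} [NormedAddCommGroup E] [Lattice E] [HasSolidNorm E] [IsOrderedAddMonoid E]
  [NormedSpace ℝ E] {T : E →L[ℝ] E}

/-- An operator is ideal-irreducible if it has no nontrivial invariant closed ideal. -/
def IsIdealIrreducible (T : E →L[ℝ] E) : Prop :=
  ∀ L : Submodule ℝ E, IsClosedIdeal L → InvariantUnder T L → L = ⊥ ∨ L = ⊤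

theorem IsIdealIrreducible.eq_zero_of_apply_eq_zero (hirr : IsIdealIrreducible T) (hT : IsPos T)
    {V W : E →L[ℝ] E} (hV : IsPos V) (hV0 : V ≠ 0) (hVT : V * T = W * V) {y : E}
    (hy : V |y| = 0) : y = 0 := by
  have hinv : InvariantUnder T (nullIdeal V hV) := by
    intro x hx
    rw [mem_nullIdeal] at hx ⊢
    refine le_antisymm ((hV.mono (hT.abs_apply_le x)).trans_eq ?_) (hV _ (abs_nonneg _))
    change (V * T) |x| = 0
    rw [hVT, mul_apply_eq_comp, hx, map_zero]
  rcases hirr _ (isClosedIdeal_nullIdeal hV) hinv with h | h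
  · have : y ∈ nullIdeal V hV := hy
    rwa [h, Submodule.mem_bot] at this
  · exfalso
    refine hV0 (ContinuousLinearMap.ext fun x => ?_)
    have hx : x ∈ nullIdeal V hV := h ▸ Submodule.mem_top
    rw [mem_nullIdeal] at hx
    have := hV.abs_apply_le x
    rw [hx] at this
    exact eq_zero_of_abs_nonpos this

/-- The operators `m • (1 + T + ⋯ + T ^ (m - 1))`. -/
def orbitSum (T : E →L[ℝ] E) (m : ℕ) : E →L[ℝ] E := m • ∑ k ∈ Finset.range m, T ^ k

theorem orbitSum_apply (m : ℕ) (y : E) :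
    orbitSum T m y = m • ∑ k ∈ Finset.range m, (T ^ k) y := by
  rw [orbitSum, smul_apply, sum_apply]

theorem commute_orbitSum (m : ℕ) : Commute (orbitSum T m) T :=
  (Commute.sum_left _ _ _ fun k _ => (Commute.refl T).pow_left k).smul_left m

theorem IsPos.sum_nonneg (hT : IsPos T) {y : E} (hy : 0 ≤ y) (m : ℕ) :
    0 ≤ ∑ k ∈ Finset.range m, (T ^ k) y :=
  Finset.sum_nonneg fun k _ => hT.pow k y hy

theorem IsPos.orbitSum (hT : IsPos T) (m : ℕ) : IsPos (orbitSum T m) := fun y hy => by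
  rw [orbitSum_apply]
  exact nsmul_nonneg (hT.sum_nonneg hy m) m

theorem IsPos.sum_mono (hT : IsPos T) {y : E} (hy : 0 ≤ y) {m n : ℕ} (h : m ≤ n) :
    ∑ k ∈ Finset.range m, (T ^ k) y ≤ ∑ k ∈ Finset.range n, (T ^ k) y :=
  Finset.sum_le_sum_of_subset_of_nonneg (Finset.range_mono h) fun k _ _ => hT.pow k y hy

theorem orbitSum_mono (hT : IsPos T) {y : E} (hy : 0 ≤ y) {m n : ℕ} (h : m ≤ n) :
    orbitSum T m y ≤ orbitSum T n y := by
  rw [orbitSum_apply, orbitSum_apply]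
  exact (nsmul_le_nsmul_right (hT.sum_mono hy h) m).trans
    (nsmul_le_nsmul_left (hT.sum_nonneg hy n) h)

theorem orbitSum_add_le (hT : IsPos T) {y : E} (hy : 0 ≤ y) (m n : ℕ) :
    ∃ k, orbitSum T m y + orbitSum T n y ≤ orbitSum T k y := by
  refine ⟨m + n, ?_⟩
  rw [orbitSum_apply, orbitSum_apply, orbitSum_apply, add_nsmul]
  exact add_le_add (nsmul_le_nsmul_right (hT.sum_mono hy (Nat.le_add_right _ _)) m)
    (nsmul_le_nsmul_right (hT.sum_mono hy (Nat.le_add_left _ _)) n)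

theorem apply_orbitSum_le (hT : IsPos T) {y : E} (hy : 0 ≤ y) (m : ℕ) :
    T (orbitSum T m y) ≤ orbitSum T (m + 1) y := by
  rw [orbitSum_apply, orbitSum_apply, map_nsmul, map_sum]
  have h1 : ∑ k ∈ Finset.range m, T ((T ^ k) y) ≤ ∑ k ∈ Finset.range (m + 1), (T ^ k) y := by
    rw [Finset.sum_range_succ']
    refine le_add_of_le_of_nonneg (Finset.sum_le_sum fun k _ => ?_) (by simpa using hy)
    rw [pow_succ']
    rfl
  exact (nsmul_le_nsmul_right h1 m).trans
    (nsmul_le_nsmul_left (hT.sum_nonneg hy _) (Nat.le_succ m))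

/-- The ideal generated by the orbit of a nonzero positive vector under an ideal-irreducible
operator is dense. -/
theorem IsIdealIrreducible.closure_dominated (hirr : IsIdealIrreducible T) (hT : IsPos T) {y : E}
    (hy : 0 ≤ y) (hy0 : y ≠ 0) :
    (dominated (fun m => orbitSum T m y) (fun m => hT.orbitSum m y hy)
      (orbitSum_add_le hT hy)).topologicalClosure = ⊤ := by
  set L := dominated (fun m => orbitSum T m y) (fun m => hT.orbitSum m y hy)
    (orbitSum_add_le hT hy)
  have hideal : IsClosedIdeal L.topologicalClosure :=
    isClosedIdeal_topologicalClosure fun u v huv ⟨m, hm⟩ => ⟨m, huv.trans hm⟩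
  have hinv : InvariantUnder T L.topologicalClosure := by
    intro x hx
    rw [← SetLike.mem_coe, Submodule.topologicalClosure_coe] at hx ⊢
    refine map_mem_closure T.continuous hx ?_
    rintro u ⟨m, hm⟩
    exact ⟨m + 1, (hT.abs_apply_le u).trans ((hT.mono hm).trans (apply_orbitSum_le hT hy m))⟩
  refine (hirr _ hideal hinv).resolve_left fun h => hy0 ?_
  have : y ∈ L.topologicalClosure :=
    L.le_topologicalClosure ⟨1, by simp [orbitSum_apply, abs_of_nonneg hy]⟩
  rwa [h, Submodule.mem_bot] at this

theorem IsIdealIrreducible.exists_norm_sub_inf_lt (hirr : IsIdealIrreducible T) (hT : IsPos T)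
    {y : E} (hy : 0 ≤ y) (hy0 : y ≠ 0) (x : E) {r : ℝ} (hr : 0 < r) :
    ∃ m, ‖x - x ⊓ orbitSum T m y‖ < r := by
  have hx : x ∈ closure (dominated (fun m => orbitSum T m y) (fun m => hT.orbitSum m y hy)
      (orbitSum_add_le hT hy) : Set E) := by
    rw [← Submodule.topologicalClosure_coe, hirr.closure_dominated hT hy hy0]
    trivial
  obtain ⟨z, ⟨m, hm⟩, hz⟩ := Metric.mem_closure_iff.1 hx r hr
  refine ⟨m, lt_of_le_of_lt (norm_le_norm_of_abs_le_abs ?_) (by rwa [dist_eq_norm] at hz)⟩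
  rw [abs_of_nonneg (sub_nonneg.2 inf_le_left), sub_le_comm]
  refine le_inf (sub_le_self _ (abs_nonneg _)) ?_
  rw [sub_le_comm]
  exact (sub_le_sub_left ((le_abs_self z).trans hm) x).trans (le_abs_self _)

/-- A nonzero power-compact positive ideal-irreducible operator is not quasi-nilpotent. -/
theorem IsIdealIrreducible.not_pow_decay (hirr : IsIdealIrreducible T) (hT : IsPos T)
    (hT0 : T ≠ 0) {N : ℕ} (hN1 : 1 ≤ N) (hN : IsCompactOperator ⇑(T ^ N)) :
    ¬ ∀ ε : ℝ, 0 < ε → ∃ C : ℝ, ∀ k, ‖T ^ k‖ ≤ C * ε ^ k := by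
  intro hdecay
  have hinj : ∀ n : ℕ, ∀ y, 0 ≤ y → (T ^ n) y = 0 → y = 0 := by
    intro n
    induction n with
    | zero => intro y _ h; simpa using h
    | succ n ih =>
      intro y hy h
      rw [pow_succ] at h
      have h1 := ih (T y) (hT y hy) h
      exact hirr.eq_zero_of_apply_eq_zero hT hT hT0 rfl (by rwa [abs_of_nonneg hy])
  obtain ⟨x₀, hx₀, hKx₀⟩ : ∃ x : E, 0 ≤ x ∧ (T ^ N) x ≠ 0 := by
    obtain ⟨x, hx⟩ : ∃ x, T x ≠ 0 := by
      by_contra! h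
      exact hT0 (ContinuousLinearMap.ext h)
    refine ⟨|x|, abs_nonneg x, fun h => hx ?_⟩
    rw [eq_zero_of_abs_eq_zero (hinj N _ (abs_nonneg x) h), map_zero]
  have hx₀0 : x₀ ≠ 0 := by rintro rfl; simp at hKx₀
  obtain ⟨r, hr, hr1, hr2⟩ : ∃ r : ℝ, 0 < r ∧ r < ‖x₀‖ ∧ ‖T ^ N‖ * r < ‖(T ^ N) x₀‖ := by
    have h1 : ∀ᶠ r : ℝ in 𝓝[>] 0, r < ‖x₀‖ :=
      nhdsWithin_le_nhds (gt_mem_nhds (norm_pos_iff.2 hx₀0))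
    have h2 : ∀ᶠ r : ℝ in 𝓝[>] 0, ‖T ^ N‖ * r < ‖(T ^ N) x₀‖ := by
      refine nhdsWithin_le_nhds ((Continuous.tendsto (by fun_prop) 0).eventually_lt_const ?_)
      simpa using hKx₀
    obtain ⟨r, ⟨h1, h2⟩, h3⟩ := ((h1.and h2).and self_mem_nhdsWithin).exists
    exact ⟨r, h3, h1, h2⟩
  set D : Set E := {y | 0 ≤ y ∧ ‖y - x₀‖ ≤ r} with hD
  have hDK : ∀ y ∈ D, 0 ≤ (T ^ N) y ∧ ‖(T ^ N) x₀‖ - ‖T ^ N‖ * r ≤ ‖(T ^ N) y‖ := by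
    rintro y ⟨hy, hyr⟩
    refine ⟨hT.pow N y hy, ?_⟩
    have h1 : ‖(T ^ N) (y - x₀)‖ ≤ ‖T ^ N‖ * r :=
      ((T ^ N).le_opNorm _).trans (mul_le_mul_of_nonneg_left hyr (norm_nonneg _))
    rw [map_sub] at h1
    have h2 := norm_sub_norm_le ((T ^ N) x₀) ((T ^ N) y)
    rw [norm_sub_rev] at h2
    linarith
  obtain ⟨Q, hQ, hQD⟩ : ∃ Q : Set E, IsCompact Q ∧ (T ^ N) '' D ⊆ Q ∧
      ∀ q ∈ Q, 0 ≤ q ∧ q ≠ 0 := by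
    have hb : Bornology.IsBounded D :=
      (Metric.isBounded_closedBall (x := x₀) (r := r)).subset fun y hy => by
        simpa [dist_eq_norm] using hy.2
    refine ⟨closure ((T ^ N) '' D), hN.isCompact_closure_image_of_bounded hb, subset_closure, ?_⟩
    have hcl : IsClosed {q : E | 0 ≤ q ∧ ‖(T ^ N) x₀‖ - ‖T ^ N‖ * r ≤ ‖q‖} :=
      isClosed_nonneg.inter (isClosed_le continuous_const continuous_norm)
    intro q hq
    have := closure_minimal (by rintro _ ⟨y, hy, rfl⟩; exact hDK y hy) hcl hq
    refine ⟨this.1, ?_⟩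
    rintro rfl
    have := this.2
    rw [norm_zero] at this
    linarith
  obtain ⟨m, hm⟩ : ∃ m, Q ⊆ {q | ‖x₀ - x₀ ⊓ orbitSum T m |q|‖ < r} := by
    refine hQ.elim_directed_cover _ (fun m => ?_) (fun q hq => ?_) ?_
    · refine isOpen_lt ?_ continuous_const
      have : Continuous fun q : E => |q| := continuous_id.sup continuous_neg
      fun_prop
    · obtain ⟨m, hm⟩ := hirr.exists_norm_sub_inf_lt hT (hQD.2 q hq).1 (hQD.2 q hq).2 x₀ hr
      refine Set.mem_iUnion.2 ⟨m, ?_⟩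
      simpa [abs_of_nonneg (hQD.2 q hq).1] using hm
    · refine directed_of_isDirected_le fun m n hmn q (hq : ‖_‖ < r) =>
        show ‖_‖ < r from lt_of_le_of_lt ?_ hq
      refine norm_le_norm_of_nonneg (sub_nonneg.2 inf_le_left) (sub_le_sub_left ?_ _)
      exact inf_le_inf_left _ (orbitSum_mono hT (abs_nonneg q) hmn)
  set S := orbitSum T m with hS
  let y : ℕ → E := fun n => Nat.rec x₀ (fun _ z => x₀ ⊓ S ((T ^ N) z)) n
  have hyD : ∀ n, y n ∈ D := by
    intro n
    induction n with
    | zero => exact ⟨hx₀, by simpa [y] using hr.le⟩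
    | succ n ih =>
      have h1 : 0 ≤ (T ^ N) (y n) := (hDK _ ih).1
      refine ⟨le_inf hx₀ (hT.orbitSum m _ h1), ?_⟩
      have := hm (hQD.1 ⟨y n, ih, rfl⟩)
      rw [Set.mem_ofPred_eq, abs_of_nonneg h1] at this
      rw [norm_sub_rev]
      exact this.le
  have hSpos : IsPos S := hT.orbitSum m
  have hyle : ∀ n, y n ≤ ((S * T ^ N) ^ n) x₀ := by
    intro n
    induction n with
    | zero => simp [y]
    | succ n ih =>
      rw [pow_succ']
      exact inf_le_right.trans ((hSpos.mul (hT.pow N)).mono ih)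
  obtain ⟨ε, hε, hε1⟩ : ∃ ε : ℝ, 0 < ε ∧ ‖S‖ * ε ^ N < 1 / 2 := by
    have h1 : ∀ᶠ ε : ℝ in 𝓝[>] 0, ‖S‖ * ε ^ N < 1 / 2 := by
      refine nhdsWithin_le_nhds ((Continuous.tendsto (by fun_prop) 0).eventually_lt_const ?_)
      rw [zero_pow (by omega), mul_zero]
      norm_num
    obtain ⟨ε, h1, h2⟩ := (h1.and self_mem_nhdsWithin).exists
    exact ⟨ε, h2, h1⟩
  obtain ⟨C, hC⟩ := hdecay ε hε
  have hC0 : 0 ≤ C := by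
    have := hC 0
    rw [pow_zero, pow_zero, mul_one] at this
    exact (norm_nonneg _).trans this
  have hbound : ∀ n, ‖x₀‖ - r ≤ C * (1 / 2) ^ n * ‖x₀‖ := by
    intro n
    have h1 : ‖x₀‖ - r ≤ ‖y n‖ := by
      have h2 := norm_sub_norm_le x₀ (y n)
      rw [norm_sub_rev] at h2
      linarith [(hyD n).2]
    have hcomm : Commute S (T ^ N) := (commute_orbitSum m).pow_right N
    have h2 : ‖(S * T ^ N) ^ n‖ ≤ C * (1 / 2) ^ n := by
      rw [hcomm.mul_pow, ← pow_mul]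
      calc ‖S ^ n * T ^ (N * n)‖ ≤ ‖S‖ ^ n * (C * ε ^ (N * n)) := by
            refine (norm_mul_le _ _).trans ?_
            gcongr
            · cases n with
              | zero =>
                rw [pow_zero, pow_zero]
                exact ContinuousLinearMap.norm_id_le
              | succ n => exact norm_pow_le' _ n.succ_pos
            · exact hC _
        _ = C * (‖S‖ * ε ^ N) ^ n := by rw [mul_pow, ← pow_mul]; ring
        _ ≤ C * (1 / 2) ^ n := by gcongr
    calc ‖x₀‖ - r ≤ ‖y n‖ := h1
      _ ≤ ‖((S * T ^ N) ^ n) x₀‖ := norm_le_norm_of_nonneg (hyD n).1 (hyle n)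
      _ ≤ ‖(S * T ^ N) ^ n‖ * ‖x₀‖ := ContinuousLinearMap.le_opNorm _ _
      _ ≤ C * (1 / 2) ^ n * ‖x₀‖ := by gcongr
  have hlim : Tendsto (fun n : ℕ => C * (1 / 2 : ℝ) ^ n * ‖x₀‖) atTop (𝓝 0) := by
    simpa using ((tendsto_pow_atTop_nhds_zero_of_lt_one (by norm_num : (0 : ℝ) ≤ 1 / 2)
      (by norm_num)).const_mul C).mul_const ‖x₀‖
  have := ge_of_tendsto' hlim hbound
  linarith

/-- Strict monotonicity of the leading eigenvalue: if `0 ≤ R ≤ T` and `T ≠ R`, with `T`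
power-compact and ideal-irreducible, then `T` has a positive eigenvalue that exceeds all the real
eigenvalues of `R`. -/
theorem IsIdealIrreducible.exists_eigenvalue [CompleteSpace E] (hirr : IsIdealIrreducible T)
    {R : E →L[ℝ] E} (hR : IsPos R) (hTR : IsPos (T - R)) (hne : T - R ≠ 0)
    {N : ℕ} (hN1 : 1 ≤ N) (hN : IsCompactOperator ⇑(T ^ N)) :
    ∃ lam : ℝ, 0 < lam ∧ (∃ u, u ≠ 0 ∧ T u = lam • u) ∧
      ∀ μ, lam ^ N ≤ μ → ∀ x, (R ^ N) x = μ • x → x = 0 := by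
  have hT : IsPos T := by simpa using hR.add hTR
  have hT0 : T ≠ 0 := by
    rintro rfl
    refine hne (ContinuousLinearMap.ext fun x => ?_)
    have h : ∀ z : E, 0 ≤ z → (0 - R) z = 0 := fun z hz =>
      le_antisymm (by simpa using hR z hz) (hTR z hz)
    have := hTR.abs_apply_le x
    rw [h _ (abs_nonneg x)] at this
    exact eq_zero_of_abs_nonpos this
  obtain ⟨lam, hlam, V, hV, hV0, hTV, hVT⟩ := (pow_decay_or_exists_eigenoperator hT hN).resolve_left
    (hirr.not_pow_decay hT hT0 hN1 hN)
  have hVinj : ∀ y, 0 ≤ y → V y = 0 → y = 0 := fun y hy h =>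
    hirr.eq_zero_of_apply_eq_zero hT hV hV0 (W := lam • 1) (by rw [hVT, smul_mul_assoc, one_mul])
      (by rwa [abs_of_nonneg hy])
  have key : ∀ z, 0 ≤ z → lam • z ≤ R z → z = 0 := by
    intro z hz hRz
    by_contra hz0
    have hRT : R z ≤ T z := by simpa using hTR z hz
    have hTz : T z = lam • z := by
      rw [← sub_eq_zero]
      refine hVinj _ (sub_nonneg.2 (hRz.trans hRT)) ?_
      rw [map_sub, map_smul, sub_eq_zero]
      exact congrArg (fun W : E →L[ℝ] E => W z) hVT
    have hCz : (T - R) z = 0 := by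
      refine le_antisymm ?_ (hTR z hz)
      rw [sub_apply, hTz, sub_nonpos]
      exact hRz
    have hpow : ∀ k, (T ^ k) z = lam ^ k • z := by
      intro k
      induction k with
      | zero => simp
      | succ k ih =>
        rw [pow_succ', mul_apply_eq_comp, ih, map_smul, hTz, smul_smul, pow_succ]
    have hCS : ∀ m, (T - R) (orbitSum T m z) = 0 := by
      intro m
      rw [orbitSum_apply, map_nsmul, map_sum]
      simp only [hpow, map_smul, hCz, smul_zero, Finset.sum_const_zero]
    have hle : (dominated (fun m => orbitSum T m z) (fun m => hT.orbitSum m z hz)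
        (orbitSum_add_le hT hz)).topologicalClosure ≤ nullIdeal (T - R) hTR := by
      refine Submodule.topologicalClosure_minimal _ ?_ (isClosedIdeal_nullIdeal hTR).1
      rintro x ⟨m, hm⟩
      exact le_antisymm ((hTR.mono hm).trans_eq (hCS m)) (hTR _ (abs_nonneg x))
    rw [hirr.closure_dominated hT hz hz0] at hle
    refine hne (ContinuousLinearMap.ext fun x => ?_)
    have h1 := hTR.abs_apply_le x
    rw [mem_nullIdeal.1 (hle (Submodule.mem_top (x := x)))] at h1
    exact eq_zero_of_abs_nonpos h1
  refine ⟨lam, hlam, ?_, ?_⟩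
  · obtain ⟨x, hx⟩ : ∃ x, V x ≠ 0 := by
      by_contra! h
      exact hV0 (ContinuousLinearMap.ext h)
    exact ⟨V x, hx, congrArg (fun W : E →L[ℝ] E => W x) hTV⟩
  · intro μ hμ x hx
    have hμ0 : 0 ≤ μ := (pow_pos hlam N).le.trans hμ
    have h1 : lam ^ N • |x| ≤ (R ^ N) |x| := by
      refine (smul_le_smul_of_nonneg_right hμ (abs_nonneg x)).trans ?_
      have h2 : μ • |x| ≤ |μ • x| := by
        rcases hμ0.eq_or_lt with rfl | hpos
        · simp
        · have := abs_smul_le μ⁻¹ (μ • x)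
          rw [inv_smul_smul₀ hpos.ne', abs_of_nonneg (inv_nonneg.2 hμ0)] at this
          have := smul_le_smul_of_nonneg_left this hμ0
          rwa [smul_inv_smul₀ hpos.ne'] at this
      rw [← hx] at h2
      exact h2.trans ((hR.pow N).abs_apply_le x)
    set G : E →L[ℝ] E := ∑ i ∈ Finset.range N, R ^ i * (lam • 1) ^ (N - 1 - i)
    have hterm : ∀ i, (R ^ i * (lam • (1 : E →L[ℝ] E)) ^ (N - 1 - i)) |x| =
        lam ^ (N - 1 - i) • (R ^ i) |x| := fun i => by
      rw [smul_pow, one_pow, mul_smul_comm, mul_one, smul_apply]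
    have hz : G |x| = ∑ i ∈ Finset.range N, lam ^ (N - 1 - i) • (R ^ i) |x| := by
      rw [sum_apply]
      exact Finset.sum_congr rfl fun i _ => hterm i
    have hnn : ∀ i ∈ Finset.range N, 0 ≤ lam ^ (N - 1 - i) • (R ^ i) |x| := fun i _ =>
      smul_nonneg (by positivity) (hR.pow i _ (abs_nonneg x))
    have hxz : lam ^ (N - 1) • |x| ≤ G |x| := by
      rw [hz]
      exact Finset.single_le_sum hnn (Finset.mem_range.2 hN1)
    have hgeom : R (G |x|) - lam • G |x| = (R ^ N) |x| - lam ^ N • |x| := by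
      have h3 := (Commute.smul_right (Commute.one_right R) lam).mul_geom_sum₂ N
      rw [sub_mul, smul_mul_assoc, one_mul, smul_pow, one_pow] at h3
      exact congrArg (fun W : E →L[ℝ] E => W |x|) h3
    have hz0 := key (G |x|) (hz ▸ Finset.sum_nonneg hnn) (by
      rw [← sub_nonneg, hgeom, sub_nonneg]
      exact h1)
    rw [hz0] at hxz
    have h5 : lam ^ (N - 1) • |x| = 0 :=
      le_antisymm hxz (smul_nonneg (by positivity) (abs_nonneg x))
    exact eq_zero_of_abs_eq_zero ((smul_eq_zero.1 h5).resolve_left (by positivity))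

end Irreducible

section Induced

variable {X : Type*} [NormedAddCommGroup X] [NormedSpace ℝ X]

/-- The restriction of an operator to an invariant subspace. -/
def restrictOp (T : X →L[ℝ] X) (I : Submodule ℝ X) (h : ∀ x ∈ I, T x ∈ I) : I →L[ℝ] I :=
  (T.comp I.subtypeL).codRestrict I fun x => h x x.2

/-- The operator induced on the quotient by an invariant subspace. -/
def quotOp (T : X →L[ℝ] X) (J : Submodule ℝ X) (h : ∀ x ∈ J, T x ∈ J) : (X ⧸ J) →L[ℝ] (X ⧸ J) :=
  J.liftQL (J.mkQL.comp T) fun x hx => (Submodule.Quotient.mk_eq_zero J).2 (h x hx)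

variable {T : X →L[ℝ] X} {I : Submodule ℝ X} (h : ∀ x ∈ I, T x ∈ I)

theorem quotOp_mk (x : X) :
    quotOp T I h (Submodule.Quotient.mk x) = Submodule.Quotient.mk (T x) := rfl

theorem pow_apply_mem (h : ∀ x ∈ I, T x ∈ I) (n : ℕ) : ∀ x ∈ I, (T ^ n) x ∈ I := by
  induction n with
  | zero => exact fun x hx => hx
  | succ n ih => exact fun x hx => by rw [pow_succ]; exact ih _ (h x hx)

theorem coe_restrictOp_pow (n : ℕ) (x : I) : ((restrictOp T I h ^ n) x : X) = (T ^ n) x := by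
  induction n generalizing x with
  | zero => rfl
  | succ n ih => rw [pow_succ, pow_succ]; exact ih _

theorem quotOp_pow_mk (n : ℕ) (x : X) :
    (quotOp T I h ^ n) (Submodule.Quotient.mk x) = Submodule.Quotient.mk ((T ^ n) x) := by
  induction n generalizing x with
  | zero => rfl
  | succ n ih => rw [pow_succ, pow_succ]; exact ih _

theorem isCompactOperator_restrictOp_pow (hI : IsClosed (I : Set X)) {n : ℕ}
    (hT : IsCompactOperator ⇑(T ^ n)) : IsCompactOperator ⇑(restrictOp T I h ^ n) := by
  have h1 := (hT.comp_clm I.subtypeL).codRestrict (V := I)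
    (fun x => pow_apply_mem h n x x.2) hI
  have h2 : ⇑(restrictOp T I h ^ n) = Set.codRestrict (⇑(T ^ n) ∘ ⇑I.subtypeL) I
      fun x => pow_apply_mem h n x x.2 := funext fun x => Subtype.ext (coe_restrictOp_pow h n x)
  rwa [h2]

theorem isCompactOperator_quotOp_pow {n : ℕ} (hT : IsCompactOperator ⇑(T ^ n)) :
    IsCompactOperator ⇑(quotOp T I h ^ n) := by
  obtain ⟨Q, hQ, hQ0⟩ := hT
  refine ⟨I.mkQL '' Q, hQ.image I.mkQL.continuous, ?_⟩
  have h1 := I.isOpenQuotientMap_mkQL.isOpenMap.image_mem_nhds hQ0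
  rw [map_zero] at h1
  refine mem_of_superset h1 ?_
  rintro _ ⟨x, hx, rfl⟩
  exact ⟨_, hx, (quotOp_pow_mk h n x).symm⟩

end Induced

section Ideal

variable {E : Type*} [NormedAddCommGroup E] [Lattice E] [HasSolidNorm E] [IsOrderedAddMonoid E]
  [NormedSpace ℝ E] {I J : Submodule ℝ E}

theorem abs_sup_le (x y : E) : |x ⊔ y| ≤ |x| + |y| := by
  rw [abs_le']
  refine ⟨sup_le ((le_abs_self x).trans (le_add_of_nonneg_right (abs_nonneg y)))
    ((le_abs_self y).trans (le_add_of_nonneg_left (abs_nonneg x))), ?_⟩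
  rw [neg_sup]
  exact inf_le_left.trans ((neg_le_abs x).trans (le_add_of_nonneg_right (abs_nonneg y)))

theorem _root_.IsClosedIdeal.sup_mem (hI : IsClosedIdeal I) {x y : E} (hx : x ∈ I) (hy : y ∈ I) :
    x ⊔ y ∈ I :=
  hI.2 _ (|x| + |y|) ((abs_sup_le x y).trans (le_abs_self _))
    (I.add_mem (hI.abs_mem hx) (hI.abs_mem hy))

theorem _root_.IsClosedIdeal.inf_mem (hI : IsClosedIdeal I) {x y : E} (hx : x ∈ I) (hy : y ∈ I) :
    x ⊓ y ∈ I := by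
  have := I.neg_mem (hI.sup_mem (I.neg_mem hx) (I.neg_mem hy))
  rwa [neg_sup, neg_neg, neg_neg] at this

instance instLatticeIdeal [hI : Fact (IsClosedIdeal I)] : Lattice I :=
  Subtype.lattice (P := (· ∈ I)) (fun _ _ hx hy => hI.out.sup_mem hx hy)
    fun _ _ hx hy => hI.out.inf_mem hx hy

section Subspace

variable [hI : Fact (IsClosedIdeal I)]

instance instIsOrderedAddMonoidIdeal : IsOrderedAddMonoid I where
  add_le_add_left x y h z := add_le_add_left (show (x : E) ≤ y from h) (z : E)

instance instHasSolidNormIdeal : HasSolidNorm I where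
  solid x y h := show ‖(x : E)‖ ≤ ‖(y : E)‖ from norm_le_norm_of_abs_le_abs h

end Subspace

theorem abs_sup_sub_sup_le (x y x' y' : E) : |x ⊔ y - x' ⊔ y'| ≤ |x - x'| + |y - y'| := by
  have h : ∀ x y x' y' : E, x ⊔ y - x' ⊔ y' ≤ |x - x'| + |y - y'| := fun x y x' y' => by
    rw [sub_le_iff_le_add]
    refine sup_le ?_ ?_
    · have := sub_le_iff_le_add.1 (le_abs_self (x - x'))
      exact this.trans (add_le_add (le_add_of_nonneg_right (abs_nonneg _)) le_sup_left)
    · have := sub_le_iff_le_add.1 (le_abs_self (y - y'))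
      exact this.trans (add_le_add (le_add_of_nonneg_left (abs_nonneg _)) le_sup_right)
  rw [abs_le', neg_sub]
  refine ⟨h _ _ _ _, ?_⟩
  rw [abs_sub_comm x, abs_sub_comm y]
  exact h _ _ _ _

variable [hJ : Fact (IsClosedIdeal J)]

instance instMaxQuotient : Max (E ⧸ J) where
  max := Quotient.map₂ (· ⊔ ·) fun x x' hx y y' hy => by
    refine (Submodule.quotientRel_def J).2 ?_
    replace hx := (Submodule.quotientRel_def J).1 hx
    replace hy := (Submodule.quotientRel_def J).1 hy
    exact hJ.out.2 _ (|x - x'| + |y - y'|) ((abs_sup_sub_sup_le _ _ _ _).trans (le_abs_self _))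
      (J.add_mem (hJ.out.abs_mem hx) (hJ.out.abs_mem hy))

instance instMinQuotient : Min (E ⧸ J) where
  min := Quotient.map₂ (· ⊓ ·) fun x x' hx y y' hy => by
    refine (Submodule.quotientRel_def J).2 ?_
    replace hx := (Submodule.quotientRel_def J).1 hx
    replace hy := (Submodule.quotientRel_def J).1 hy
    have h : |x ⊓ y - x' ⊓ y'| ≤ |x - x'| + |y - y'| := by
      have := abs_sup_sub_sup_le (-x) (-y) (-x') (-y')
      rwa [← neg_inf, ← neg_inf, ← neg_sub', abs_neg, ← neg_sub', abs_neg, ← neg_sub',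
        abs_neg] at this
    exact hJ.out.2 _ (|x - x'| + |y - y'|) (h.trans (le_abs_self _))
      (J.add_mem (hJ.out.abs_mem hx) (hJ.out.abs_mem hy))

theorem mk_sup (x y : E) : (Submodule.Quotient.mk (x ⊔ y) : E ⧸ J) =
    Submodule.Quotient.mk x ⊔ Submodule.Quotient.mk y := rfl

instance instLatticeQuotient : Lattice (E ⧸ J) :=
  Lattice.mk'
    (by rintro ⟨x⟩ ⟨y⟩; exact congrArg Submodule.Quotient.mk (sup_comm x y))
    (by rintro ⟨x⟩ ⟨y⟩ ⟨z⟩; exact congrArg Submodule.Quotient.mk (sup_assoc x y z))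
    (by rintro ⟨x⟩ ⟨y⟩; exact congrArg Submodule.Quotient.mk (inf_comm x y))
    (by rintro ⟨x⟩ ⟨y⟩ ⟨z⟩; exact congrArg Submodule.Quotient.mk (inf_assoc x y z))
    (by rintro ⟨x⟩ ⟨y⟩; exact congrArg Submodule.Quotient.mk sup_inf_self)
    (by rintro ⟨x⟩ ⟨y⟩; exact congrArg Submodule.Quotient.mk inf_sup_self)

theorem mk_abs (x : E) : (Submodule.Quotient.mk |x| : E ⧸ J) = |Submodule.Quotient.mk x| := rfl

theorem mk_nonneg {x : E} (hx : 0 ≤ x) : (0 : E ⧸ J) ≤ Submodule.Quotient.mk x := by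
  rw [← sup_eq_right, ← Submodule.Quotient.mk_zero, ← mk_sup, sup_eq_right.2 hx]

instance instIsOrderedAddMonoidQuotient : IsOrderedAddMonoid (E ⧸ J) where
  add_le_add_left := by
    intro a b h c
    obtain ⟨x, rfl⟩ := Submodule.Quotient.mk_surjective J a
    obtain ⟨y, rfl⟩ := Submodule.Quotient.mk_surjective J b
    obtain ⟨z, rfl⟩ := Submodule.Quotient.mk_surjective J c
    rw [← sup_eq_right] at h ⊢
    rw [← Submodule.Quotient.mk_add, ← Submodule.Quotient.mk_add, ← mk_sup, ← sup_add,
      Submodule.Quotient.mk_add, mk_sup, h, Submodule.Quotient.mk_add]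

instance instIsClosedOfFact : IsClosed (J : Set E) := hJ.out.1

theorem abs_le_of_mk_abs_le {x y : E}
    (h : |(Submodule.Quotient.mk x : E ⧸ J)| ≤ |Submodule.Quotient.mk y|) :
    ∃ x', x - x' ∈ J ∧ |x'| ≤ |y| := by
  rw [← sup_eq_right, ← mk_abs, ← mk_abs, ← mk_sup, Submodule.Quotient.eq] at h
  refine ⟨(x ⊓ |y|) ⊔ (-|y|), hJ.out.2 _ _ ?_ h, abs_truncate_le (abs_nonneg y) x⟩
  have hc : 0 ≤ |x| ⊔ |y| - |y| := sub_nonneg.2 le_sup_right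
  rw [abs_of_nonneg hc]
  refine abs_sub_truncate_le hc ?_
  rw [add_sub_cancel]
  exact le_sup_left

instance instHasSolidNormQuotient : HasSolidNorm (E ⧸ J) where
  solid := by
    intro a b h
    obtain ⟨x, rfl⟩ := Submodule.Quotient.mk_surjective J a
    refine le_of_forall_pos_lt_add fun ε hε => ?_
    obtain ⟨y, rfl, hy⟩ := Submodule.Quotient.norm_mk_lt b hε
    obtain ⟨x', hx', hle⟩ := abs_le_of_mk_abs_le (x := x) h
    rw [(Submodule.Quotient.eq J).2 hx']
    exact (Submodule.Quotient.norm_mk_le J x').trans_lt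
      ((norm_le_norm_of_abs_le_abs hle).trans_lt hy)

theorem mk_mono {x y : E} (h : x ≤ y) : (Submodule.Quotient.mk x : E ⧸ J) ≤
    Submodule.Quotient.mk y := by
  rw [← sup_eq_right, ← mk_sup, sup_eq_right.2 h]

theorem exists_nonneg_mk {a : E ⧸ J} (ha : 0 ≤ a) :
    ∃ x : E, 0 ≤ x ∧ Submodule.Quotient.mk x = a := by
  obtain ⟨x, rfl⟩ := Submodule.Quotient.mk_surjective J a
  exact ⟨|x|, abs_nonneg x, by rw [mk_abs, abs_of_nonneg ha]⟩

theorem isPos_quotOp {T : E →L[ℝ] E} (hT : IsPos T) (h : ∀ x ∈ J, T x ∈ J) :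
    IsPos (quotOp T J h) := fun a ha => by
  obtain ⟨x, hx, rfl⟩ := exists_nonneg_mk ha
  rw [quotOp_mk]
  exact mk_nonneg (hT x hx)

end Ideal

section Gap

variable {E : Type*} [NormedAddCommGroup E] [Lattice E] [HasSolidNorm E] [IsOrderedAddMonoid E]
  [NormedSpace ℝ E] {I J : Submodule ℝ E} {R S : E →L[ℝ] E}

theorem _root_.IsClosedIdeal.comap_subtype (hJ : IsClosedIdeal J) [Fact (IsClosedIdeal I)] :
    IsClosedIdeal (J.comap I.subtype) :=
  ⟨hJ.1.preimage continuous_subtype_val, fun x y hxy hy => hJ.2 (x : E) (y : E) hxy hy⟩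

theorem _root_.IsClosedIdeal.invariantUnder_of_le (hI : IsClosedIdeal I) (hR : IsPos R)
    (hSR : IsPos (S - R)) (hS : InvariantUnder S I) : InvariantUnder R I := fun x hx => by
  have h1 : S |x| ∈ I := hS _ (hI.abs_mem hx)
  refine hI.2 _ _ ((hR.abs_apply_le x).trans (le_trans ?_ (le_abs_self _))) h1
  simpa using hSR _ (abs_nonneg x)

/-- If no closed ideal invariant under `S` lies strictly between `J` and `I`, then the leading
eigenvalue of the operator induced by `S` on `I / J` exceeds those of a smaller operator. -/
theorem exists_eigenvalue_of_gap [CompleteSpace E] (hR : IsPos R) (hSR : IsPos (S - R))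
    (hI : IsClosedIdeal I) (hJ : IsClosedIdeal J) (hJI : J ≤ I) (hSI : InvariantUnder S I)
    (hSJ : InvariantUnder S J)
    (hgap : ∀ L, IsClosedIdeal L → InvariantUnder S L → J ≤ L → L ≤ I → L = J ∨ L = I)
    (hne : ∃ x ∈ I, (S - R) x ∉ J) {N : ℕ} (hN1 : 1 ≤ N) (hN : IsCompactOperator ⇑(S ^ N)) :
    ∃ lam : ℝ, 0 < lam ∧ (∃ u ∈ I, u ∉ J ∧ S u - lam • u ∈ J) ∧
      ∀ μ, lam ^ N ≤ μ → ∀ x ∈ I, (R ^ N) x - μ • x ∈ J → x ∈ J := by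
  have hSI' : ∀ x ∈ I, S x ∈ I := hSI
  have hRI : ∀ x ∈ I, R x ∈ I := hI.invariantUnder_of_le hR hSR hSI
  have hRJ : ∀ x ∈ J, R x ∈ J := hJ.invariantUnder_of_le hR hSR hSJ
  have : Fact (IsClosedIdeal I) := ⟨hI⟩
  set J' : Submodule ℝ I := J.comap I.subtype with hJ'
  have hJ'c : Fact (IsClosedIdeal J') := ⟨hJ.comap_subtype⟩
  have : CompleteSpace I := hI.1.completeSpace_coe
  have hSJ' : ∀ x ∈ J', restrictOp S I hSI' x ∈ J' := fun x hx => hSJ (x : E) hx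
  have hRJ' : ∀ x ∈ J', restrictOp R I hRI x ∈ J' := fun x hx => hRJ (x : E) hx
  set S' := quotOp (restrictOp S I hSI') J' hSJ' with hS'
  set R' := quotOp (restrictOp R I hRI) J' hRJ' with hR'
  have hmk : ∀ x : I, (Submodule.Quotient.mk x : I ⧸ J') = 0 ↔ (x : E) ∈ J := fun x =>
    Submodule.Quotient.mk_eq_zero J'
  have hirr : IsIdealIrreducible (E := I ⧸ J') S' := by
    intro L hL hLinv
    set L₁ : Submodule ℝ E := (L.comap J'.mkQ).map I.subtype
    have hmem : ∀ x : I, (x : E) ∈ L₁ ↔ (Submodule.Quotient.mk x : I ⧸ J') ∈ L := by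
      intro x
      constructor
      · rintro ⟨y, hy, hyx⟩
        rwa [← Subtype.ext (a1 := y) (a2 := x) hyx]
      · exact fun hx => ⟨x, hx, rfl⟩
    have hL₁I : L₁ ≤ I := by
      rintro _ ⟨x, -, rfl⟩
      exact x.2
    have hL₁ : IsClosedIdeal L₁ := by
      constructor
      · exact hI.1.isClosedEmbedding_subtypeVal.isClosedMap _
          (hL.1.preimage J'.mkQL.continuous)
      · intro x y hxy hy
        have hyI := hL₁I hy
        have hxI := hI.2 x y hxy hyI
        refine (hmem ⟨x, hxI⟩).2 (hL.2 _ _ ?_ ((hmem ⟨y, hyI⟩).1 hy))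
        rw [← mk_abs, ← mk_abs]
        exact mk_mono hxy
    have hL₁S : InvariantUnder S L₁ := fun x hx =>
      (hmem ⟨S x, hSI x (hL₁I hx)⟩).2 (hLinv _ ((hmem ⟨x, hL₁I hx⟩).1 hx))
    have hJL₁ : J ≤ L₁ := fun x hx => (hmem ⟨x, hJI hx⟩).2 (by
      rw [(hmk _).2 hx]
      exact L.zero_mem)
    rcases hgap L₁ hL₁ hL₁S hJL₁ hL₁I with h | h
    · left
      rw [eq_bot_iff]
      intro a ha
      obtain ⟨x, rfl⟩ := Submodule.Quotient.mk_surjective J' a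
      rw [Submodule.mem_bot, hmk, ← h]
      exact (hmem x).2 ha
    · right
      rw [eq_top_iff]
      intro a _
      obtain ⟨x, rfl⟩ := Submodule.Quotient.mk_surjective J' a
      refine (hmem x).1 ?_
      rw [h]
      exact x.2
  have hRpos : IsPos (E := I ⧸ J') R' := isPos_quotOp (E := I) (T := restrictOp R I hRI)
    (fun x hx => hR (x : E) hx) hRJ'
  have hSRpos : IsPos (E := I ⧸ J') (S' - R') := fun a ha => by
    obtain ⟨x, hx, rfl⟩ := exists_nonneg_mk ha
    exact mk_nonneg (x := (restrictOp S I hSI' - restrictOp R I hRI) x) (hSR (x : E) hx)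
  have hne' : S' - R' ≠ 0 := by
    obtain ⟨x, hx, hxJ⟩ := hne
    intro h0
    refine hxJ ((hmk ⟨(S - R) x, I.sub_mem (hSI x hx) (hRI x hx)⟩).1 ?_)
    exact congrArg (fun W : (I ⧸ J') →L[ℝ] (I ⧸ J') => W (Submodule.Quotient.mk ⟨x, hx⟩)) h0
  have hS'N : IsCompactOperator ⇑(S' ^ N) :=
    isCompactOperator_quotOp_pow hSJ' (isCompactOperator_restrictOp_pow hSI' hI.1 hN)
  obtain ⟨lam, hlam, ⟨u, hu0, hu⟩, hmax⟩ := hirr.exists_eigenvalue hRpos hSRpos hne' hN1 hS'N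
  refine ⟨lam, hlam, ?_, fun μ hμ x hx hxμ => ?_⟩
  · obtain ⟨x, rfl⟩ := Submodule.Quotient.mk_surjective J' u
    refine ⟨x, x.2, fun h => hu0 ((hmk x).2 h), ?_⟩
    refine (hmk (restrictOp S I hSI' x - lam • x)).1 ?_
    rw [Submodule.Quotient.mk_sub, sub_eq_zero]
    exact hu
  · refine (hmk ⟨x, hx⟩).1 (hmax μ hμ _ ?_)
    rw [← sub_eq_zero, quotOp_pow_mk]
    refine (hmk ((restrictOp R I hRI ^ N) ⟨x, hx⟩ - μ • ⟨x, hx⟩)).2 ?_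
    rw [Submodule.coe_sub, coe_restrictOp_pow]
    exact hxμ

end Gap

section CompactOperator

variable {X : Type*} [NormedAddCommGroup X] [NormedSpace ℝ X]

theorem exists_riesz {J : Submodule ℝ X} (hJ : IsClosed (J : Set X)) {u : X} (hu : u ∉ J) :
    ∃ (c : ℝ) (j : X), j ∈ J ∧ ‖c • (u - j)‖ ≤ 2 ∧ ∀ i ∈ J, 1 ≤ ‖c • (u - j) - i‖ := by
  have hne : (J : Set X).Nonempty := ⟨0, J.zero_mem⟩
  have hd : 0 < Metric.infDist u J := (hJ.notMem_iff_infDist_pos hne).1 hu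
  set d := Metric.infDist u J with hd'
  obtain ⟨j, hj, hjd⟩ := (Metric.infDist_lt_iff (r := 2 * d) hne).1 (by linarith)
  rw [dist_eq_norm] at hjd
  refine ⟨d⁻¹, j, hj, ?_, fun i hi => ?_⟩
  · rw [norm_smul, norm_inv, Real.norm_of_nonneg hd.le, inv_mul_le_iff₀ hd]
    linarith
  · have h1 : d⁻¹ • (u - j) - i = d⁻¹ • (u - (j + d • i)) := by
      rw [← sub_sub, smul_sub d⁻¹ (u - j), inv_smul_smul₀ hd.ne']
    have h2 := Metric.infDist_le_dist_of_mem (x := u) (J.add_mem hj (J.smul_mem d hi))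
    rw [dist_eq_norm] at h2
    rw [h1, norm_smul, norm_inv, Real.norm_of_nonneg hd.le, le_inv_mul_iff₀ hd, mul_one]
    exact h2

theorem le_norm_smul_sub {J : Submodule ℝ X} {y : X} (hy : ∀ i ∈ J, 1 ≤ ‖y - i‖) {μ : ℝ} {i : X}
    (hi : i ∈ J) : |μ| ≤ ‖μ • y - i‖ := by
  rcases eq_or_ne μ 0 with rfl | hμ
  · simp
  · have h1 : μ • y - i = μ • (y - μ⁻¹ • i) := by rw [smul_sub, smul_inv_smul₀ hμ]
    rw [h1, norm_smul, Real.norm_eq_abs]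
    exact le_mul_of_one_le_right (abs_nonneg μ) (hy _ (J.smul_mem _ hi))

/-- A compact operator admits no infinite sequence of almost-eigenvectors, relative to nested
subspaces, with eigenvalues bounded away from zero. -/
theorem not_exists_separated {K : X →L[ℝ] X} (hK : IsCompactOperator ⇑K) {J : ℕ → Submodule ℝ X}
    {y : ℕ → X} {μ : ℕ → ℝ} {ε : ℝ} (hε : 0 < ε) (hμ : ∀ n, ε ≤ |μ n|) (hy : ∀ n, ‖y n‖ ≤ 2)
    (hyJ : ∀ n, ∀ i ∈ J n, 1 ≤ ‖y n - i‖) (hKy : ∀ n, K (y n) - μ n • y n ∈ J n)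
    (hJ : ∀ m n, m ≠ n → K (y m) ∈ J n ∨ K (y n) ∈ J m) : False := by
  have hsep1 : ∀ m n, K (y m) ∈ J n → ε ≤ dist (K (y n)) (K (y m)) := by
    intro m n h
    have h1 : K (y n) - K (y m) = μ n • y n - (K (y m) - (K (y n) - μ n • y n)) := by abel
    rw [dist_eq_norm, h1]
    exact (hμ n).trans (le_norm_smul_sub (hyJ n) ((J n).sub_mem h (hKy n)))
  have hsep : ∀ m n, m ≠ n → ε ≤ dist (K (y m)) (K (y n)) := fun m n hmn => by
    rcases hJ m n hmn with h | h
    · rw [dist_comm]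
      exact hsep1 m n h
    · exact hsep1 n m h
  have hQ : IsCompact (closure (K '' Metric.closedBall 0 2)) :=
    hK.isCompact_closure_image_of_bounded Metric.isBounded_closedBall
  obtain ⟨a, -, φ, hφ, hlim⟩ := hQ.tendsto_subseq (x := fun n => K (y n)) fun n =>
    subset_closure ⟨y n, by simpa using hy n, rfl⟩
  obtain ⟨n₀, hn₀⟩ := Metric.cauchySeq_iff.1 hlim.cauchySeq ε hε
  have := hn₀ n₀ le_rfl (n₀ + 1) n₀.le_succ
  exact absurd this (not_lt.2 (hsep _ _ (hφ.injective.ne (by omega))))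

/-- The generalized eigenspace of an operator. -/
def genSpace (K : X →L[ℝ] X) (μ : ℝ) : Submodule ℝ X where
  carrier := {x | ∃ k : ℕ, ((K - μ • 1 : X →L[ℝ] X) ^ k) x = 0}
  zero_mem' := ⟨0, map_zero _⟩
  add_mem' := by
    rintro x y ⟨k, hk⟩ ⟨l, hl⟩
    refine ⟨k + l, ?_⟩
    have h1 : ((K - μ • 1) ^ (k + l)) x = 0 := by
      rw [add_comm, pow_add, mul_apply_eq_comp, hk, map_zero]
    have h2 : ((K - μ • 1) ^ (k + l)) y = 0 := by
      rw [pow_add, mul_apply_eq_comp, hl, map_zero]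
    rw [map_add, h1, h2, add_zero]
  smul_mem' := by
    rintro c x ⟨k, hk⟩
    exact ⟨k, by rw [map_smul, hk, smul_zero]⟩

variable {K : X →L[ℝ] X} {μ : ℝ}

theorem sub_smul_one_apply (x : X) : (K - μ • 1) x = K x - μ • x := rfl

theorem mem_genSpace_of_pow_mem {k : ℕ} {x : X} (h : ((K - μ • 1) ^ k) x ∈ genSpace K μ) :
    x ∈ genSpace K μ := by
  obtain ⟨l, hl⟩ := h
  exact ⟨l + k, by rwa [pow_add]⟩

theorem apply_mem_genSpace {T : X →L[ℝ] X} (hT : Commute T K) {x : X} (hx : x ∈ genSpace K μ) :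
    T x ∈ genSpace K μ := by
  obtain ⟨k, hk⟩ := hx
  refine ⟨k, ?_⟩
  have h1 : Commute ((K - μ • 1) ^ k) T :=
    ((hT.sub_right ((Commute.one_right T).smul_right μ)).pow_right k).symm
  rw [← mul_apply_eq_comp, h1.eq, mul_apply_eq_comp, hk, map_zero]

theorem sub_smul_one_mem {J : Submodule ℝ X} (hJ : ∀ x ∈ J, K x ∈ J) :
    ∀ x ∈ J, (K - μ • 1) x ∈ J := fun x hx => J.sub_mem (hJ x hx) (J.smul_mem μ hx)

theorem ker_pow_le_ker_pow_succ (D : X →L[ℝ] X) (k : ℕ) :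
    (D ^ k).ker ≤ (D ^ (k + 1)).ker := fun x hx => by
  rw [LinearMap.mem_ker] at hx ⊢
  change (D ^ (k + 1)) x = 0
  rw [pow_succ', mul_apply_eq_comp, show (D ^ k) x = 0 from hx, map_zero]

theorem fg_ker_sub (hK : IsCompactOperator ⇑K) (hμ : μ ≠ 0) : (K - μ • 1).ker.FG := by
  set V := (K - μ • 1).ker with hV
  have hVK : ∀ x ∈ V, K x = μ • x := fun x hx => sub_eq_zero.1 hx
  have hVinv : ∀ x ∈ V, K x ∈ V := fun x hx => by
    rw [hVK x hx]
    exact V.smul_mem μ hx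
  have hVc : IsClosed (V : Set X) := (K - μ • 1).isClosed_ker
  have h1 : IsCompactOperator ⇑(restrictOp K V hVinv ^ 1) :=
    isCompactOperator_restrictOp_pow hVinv hVc (by rwa [pow_one])
  have h2 : IsCompactOperator (id : V → V) := by
    have h2 : (id : V → V) = μ⁻¹ • ⇑(restrictOp K V hVinv ^ 1) := by
      funext x
      refine Subtype.ext ?_
      change (x : X) = μ⁻¹ • (K x)
      rw [hVK x x.2, inv_smul_smul₀ hμ]
    rw [h2]
    exact h1.smul μ⁻¹
  exact Submodule.fg_iff_finiteDimensional _ |>.2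
    (FiniteDimensional.of_isCompactOperator_id (𝕜 := ℝ) h2)

theorem fg_ker_sub_pow (hK : IsCompactOperator ⇑K) (hμ : μ ≠ 0) (k : ℕ) :
    ((K - μ • 1) ^ k).ker.FG := by
  induction k with
  | zero =>
    have : ((K - μ • 1) ^ 0).ker = ⊥ := by
      rw [eq_bot_iff]
      exact fun x hx => hx
    rw [this]
    exact Submodule.fg_bot
  | succ k ih =>
    refine Submodule.fg_of_fg_map_of_fg_inf_ker (K - μ • 1 : X →L[ℝ] X).toLinearMap ?_ ?_
    · have := Submodule.fg_iff_finiteDimensional _ |>.1 ih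
      refine Submodule.FG.of_le ih ?_
      rintro _ ⟨x, hx, rfl⟩
      have hx' : ((K - μ • 1) ^ (k + 1)) x = 0 := hx
      rwa [pow_succ] at hx'
    · exact Submodule.FG.of_le (fg_ker_sub hK hμ) inf_le_right

theorem fg_genSpace (hK : IsCompactOperator ⇑K) (hμ : μ ≠ 0) : (genSpace K μ).FG := by
  obtain ⟨k, hk⟩ : ∃ k, ((K - μ • 1) ^ (k + 1)).ker ≤ ((K - μ • 1) ^ k).ker := by
    by_contra! h
    have h1 : ∀ k, ∃ y ∈ ((K - μ • 1) ^ (k + 1)).ker, ‖y‖ ≤ 2 ∧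
        ∀ i ∈ ((K - μ • 1) ^ k).ker, 1 ≤ ‖y - i‖ := by
      intro k
      obtain ⟨u, hu, huk⟩ := SetLike.not_le_iff_exists.1 (h k)
      obtain ⟨c, j, hj, hn, hd⟩ := exists_riesz ((K - μ • 1) ^ k).isClosed_ker huk
      exact ⟨_, Submodule.smul_mem _ c (Submodule.sub_mem _ hu
        (ker_pow_le_ker_pow_succ _ k hj)), hn, hd⟩
    choose y hy1 hy2 hy3 using h1
    have hmono : Monotone fun k => ((K - μ • 1) ^ k).ker :=
      monotone_nat_of_le_succ (ker_pow_le_ker_pow_succ _)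
    have hlt : ∀ m n, m < n → K (y m) ∈ ((K - μ • 1) ^ n).ker := by
      intro m n hmn
      have h2 : ((K - μ • 1) ^ n) (y m) = 0 := hmono hmn (hy1 m)
      have h3 : Commute ((K - μ • 1) ^ n) K :=
        (((Commute.refl K).sub_left ((Commute.one_left K).smul_left μ)).pow_left n)
      change ((K - μ • 1) ^ n) (K (y m)) = 0
      rw [← mul_apply_eq_comp, h3.eq, mul_apply_eq_comp, h2, map_zero]
    refine not_exists_separated hK (μ := fun _ => μ) (abs_pos.2 hμ) (fun _ => le_rfl) hy2 hy3
      (fun n => ?_) fun m n hmn => ?_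
    · have h2 : ((K - μ • 1) ^ (n + 1)) (y n) = 0 := hy1 n
      rwa [pow_succ] at h2
    · rcases hmn.lt_or_gt with h2 | h2
      · exact Or.inl (hlt m n h2)
      · exact Or.inr (hlt n m h2)
  have hstab : ∀ l, ((K - μ • 1) ^ (k + l)).ker ≤ ((K - μ • 1) ^ k).ker := by
    intro l
    induction l with
    | zero => exact le_rfl
    | succ l ih =>
      intro x hx
      have hx' : ((K - μ • 1) ^ (k + (l + 1))) x = 0 := hx
      rw [← add_assoc, pow_succ] at hx'
      have h1 : ((K - μ • 1) ^ k) ((K - μ • 1) x) = 0 := ih hx'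
      refine hk ?_
      change ((K - μ • 1) ^ (k + 1)) x = 0
      rw [pow_succ]
      exact h1
  refine Submodule.FG.of_le (fg_ker_sub_pow hK hμ k) ?_
  rintro x ⟨l, hl⟩
  refine hstab l ?_
  change ((K - μ • 1) ^ (k + l)) x = 0
  rw [pow_add, mul_apply_eq_comp, hl, map_zero]

theorem exists_sub_mem_genSpace [CompleteSpace X] (hK : IsCompactOperator ⇑K) (hμ : μ ≠ 0)
    (w : X) : ∃ z, (K - μ • 1) z - w ∈ genSpace K μ := by
  set M := genSpace K μ with hM
  have hMK : ∀ x ∈ M, K x ∈ M := fun x hx => apply_mem_genSpace (Commute.refl K) hx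
  have := (Submodule.fg_iff_finiteDimensional _).1 (fg_genSpace hK hμ)
  have hMc : IsClosed (M : Set X) := M.closed_of_finiteDimensional
  have hK' : IsCompactOperator ⇑(quotOp K M hMK) := by
    have := isCompactOperator_quotOp_pow hMK (n := 1) (by rwa [pow_one])
    rwa [pow_one] at this
  rcases hK'.hasEigenvalue_or_mem_resolventSet hμ with h | h
  · exfalso
    obtain ⟨a, ha⟩ := h.exists_hasEigenvector
    obtain ⟨x, rfl⟩ := Submodule.Quotient.mk_surjective M a
    refine ha.2 ((Submodule.Quotient.mk_eq_zero M).2 ?_)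
    refine mem_genSpace_of_pow_mem (k := 1) ?_
    rw [pow_one]
    exact (Submodule.Quotient.eq M).1 ha.apply_eq_smul
  · obtain ⟨W, hW⟩ := h.exists_right_inv
    obtain ⟨z, hz⟩ := Submodule.Quotient.mk_surjective M (W (Submodule.Quotient.mk w))
    have h1 := congrArg (fun V : (X ⧸ M) →L[ℝ] (X ⧸ M) => V (Submodule.Quotient.mk w)) hW
    have h2 : μ • W (Submodule.Quotient.mk w) - quotOp K M hMK (W (Submodule.Quotient.mk w)) =
      Submodule.Quotient.mk w := h1
    rw [← hz] at h2
    have h3 := (Submodule.Quotient.eq M (x := μ • z - K z) (y := w)).1 h2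
    refine ⟨-z, ?_⟩
    rw [sub_smul_one_apply, map_neg, smul_neg]
    convert h3 using 1
    abel

theorem exists_pow_sub_mem_genSpace [CompleteSpace X] (hK : IsCompactOperator ⇑K) (hμ : μ ≠ 0)
    (k : ℕ) (w : X) : ∃ z, ((K - μ • 1) ^ k) z - w ∈ genSpace K μ := by
  induction k with
  | zero => exact ⟨w, by simp⟩
  | succ k ih =>
    obtain ⟨z', hz'⟩ := ih
    obtain ⟨z, hz⟩ := exists_sub_mem_genSpace hK hμ z'
    refine ⟨z, ?_⟩
    have h1 : Commute ((K - μ • 1) ^ k) K :=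
      (((Commute.refl K).sub_left ((Commute.one_left K).smul_left μ)).pow_left k)
    have h2 := (genSpace K μ).add_mem (apply_mem_genSpace h1 hz) hz'
    rwa [map_sub, sub_add_sub_cancel, ← mul_apply_eq_comp, ← pow_succ] at h2

/-- Generalized eigenvectors modulo an invariant subspace lift to generalized eigenvectors. -/
theorem exists_sub_mem_genSpace_of_pow_mem [CompleteSpace X] (hK : IsCompactOperator ⇑K)
    (hμ : μ ≠ 0) {J : Submodule ℝ X} (hJ : IsClosed (J : Set X)) (hJK : ∀ x ∈ J, K x ∈ J) {k : ℕ}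
    {x : X} (hx : ((K - μ • 1) ^ k) x ∈ J) : ∃ j ∈ J, x - j ∈ genSpace K μ := by
  have : CompleteSpace J := hJ.completeSpace_coe
  have hK' : IsCompactOperator ⇑(restrictOp K J hJK) := by
    have := isCompactOperator_restrictOp_pow hJK hJ (n := 1) (by rwa [pow_one])
    rwa [pow_one] at this
  have hpow : ∀ (l : ℕ) (z : J), ((((restrictOp K J hJK - μ • 1) ^ l) z : J) : X) =
      ((K - μ • 1) ^ l) z := by
    intro l
    induction l with
    | zero => exact fun z => rfl
    | succ l ih => exact fun z => by rw [pow_succ, pow_succ]; exact ih _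
  obtain ⟨z, l, hz⟩ := exists_pow_sub_mem_genSpace hK' hμ k ⟨_, hx⟩
  refine ⟨z, z.2, mem_genSpace_of_pow_mem (k := k) ⟨l, ?_⟩⟩
  have h1 := congrArg (Subtype.val) hz
  rw [hpow, Submodule.coe_sub, hpow] at h1
  rw [← neg_sub (z : X) x, map_neg, map_neg, neg_eq_zero, map_sub]
  exact h1

/-- The generalized eigenspaces of a compact operator are continuous from below along chains of
invariant closed subspaces. -/
theorem exists_genSpace_inf_le (hK : IsCompactOperator ⇑K) (hμ : μ ≠ 0)
    {𝒮 : Set (Submodule ℝ X)} (hne : 𝒮.Nonempty) (hchain : IsChain (· ≤ ·) 𝒮)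
    (hcl : ∀ I ∈ 𝒮, IsClosed (I : Set X)) (hinv : ∀ I ∈ 𝒮, ∀ x ∈ I, K x ∈ I) :
    ∃ I ∈ 𝒮, genSpace K μ ⊓ (sSup 𝒮).topologicalClosure ≤ I := by
  set L := (sSup 𝒮).topologicalClosure with hL
  have hdir : DirectedOn (· ≤ ·) 𝒮 := hchain.directedOn
  have hLcl : IsClosed (L : Set X) := (sSup 𝒮).isClosed_topologicalClosure
  have hmem : ∀ x, x ∈ sSup 𝒮 ↔ ∃ I ∈ 𝒮, x ∈ I := fun x => Submodule.mem_sSup_of_directed hne hdir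
  have hLinv : ∀ x ∈ L, K x ∈ L := fun x hx => by
    refine map_mem_closure K.continuous hx fun z hz => ?_
    obtain ⟨I, hI, hzI⟩ := (hmem z).1 hz
    exact (hmem _).2 ⟨I, hI, hinv I hI z hzI⟩
  obtain ⟨I₀, hI₀, hI₀L⟩ : ∃ I ∈ 𝒮, ∀ z ∈ L, ‖z‖ ≤ 2 → ∃ i ∈ I, ‖K z - i‖ < |μ| := by
    have hQ : IsCompact (closure (K '' Metric.closedBall 0 2) ∩ L) :=
      (hK.isCompact_closure_image_of_bounded Metric.isBounded_closedBall).inter_right hLcl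
    have : Nonempty 𝒮 := hne.to_subtype
    set U : 𝒮 → Set X := fun I => ⋃ i ∈ (I : Submodule ℝ X), Metric.ball i |μ| with hU
    have hcover : closure (K '' Metric.closedBall 0 2) ∩ L ⊆ ⋃ I, U I := fun q hq => by
      obtain ⟨i, hi, h⟩ := Metric.mem_closure_iff.1 hq.2 |μ| (abs_pos.2 hμ)
      obtain ⟨I, hI, hiI⟩ := (hmem i).1 hi
      exact Set.mem_iUnion.2 ⟨⟨I, hI⟩, Set.mem_biUnion hiI h⟩
    have hdU : Directed (· ⊆ ·) U := fun I₁ I₂ => by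
      obtain ⟨I₃, h3, h13, h23⟩ := hdir I₁ I₁.2 I₂ I₂.2
      exact ⟨⟨I₃, h3⟩, Set.biUnion_subset_biUnion_left h13, Set.biUnion_subset_biUnion_left h23⟩
    obtain ⟨I, hI⟩ := hQ.elim_directed_cover U
      (fun I => isOpen_biUnion fun i _ => Metric.isOpen_ball) hcover hdU
    refine ⟨I, I.2, fun z hz hz2 => ?_⟩
    have := hI ⟨subset_closure ⟨z, by simpa using hz2, rfl⟩, hLinv z hz⟩
    simpa only [hU, Set.mem_iUnion, Metric.mem_ball, dist_eq_norm, exists_prop] using this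
  have hpt : ∀ k : ℕ, ∀ x ∈ L, ((K - μ • 1 : X →L[ℝ] X) ^ k) x = 0 → x ∈ sSup 𝒮 := by
    intro k
    induction k with
    | zero =>
      intro x _ hx
      rw [show x = 0 from hx]
      exact Submodule.zero_mem _
    | succ k ih =>
      intro x hx hxk
      rw [pow_succ] at hxk
      obtain ⟨I₁, hI₁, hx₁⟩ := (hmem _).1 (ih _ (sub_smul_one_mem hLinv x hx) hxk)
      obtain ⟨I, hI, h0, h1⟩ := hdir I₀ hI₀ I₁ hI₁
      by_contra hxS
      have hxI : x ∉ I := fun h => hxS ((hmem x).2 ⟨I, hI, h⟩)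
      have hIL : I ≤ L := (le_sSup hI).trans (Submodule.le_topologicalClosure _)
      obtain ⟨c, j, hj, hn, hd⟩ := exists_riesz (hcl I hI) hxI
      obtain ⟨i, hi, hlt⟩ := hI₀L _ (L.smul_mem c (L.sub_mem hx (hIL hj))) hn
      refine absurd hlt (not_lt.2 ?_)
      set y := c • (x - j) with hy
      have hDy : (K - μ • 1) y ∈ I := by
        rw [hy, map_smul, map_sub]
        exact I.smul_mem c (I.sub_mem (h1 hx₁) (sub_smul_one_mem (hinv I hI) j hj))
      have h2 : K y - i = μ • y - (i - (K - μ • 1) y) := by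
        rw [sub_smul_one_apply]
        abel
      rw [h2]
      exact le_norm_smul_sub hd (I.sub_mem (h0 hi) hDy)
  have hfg : (genSpace K μ ⊓ L).FG := Submodule.FG.of_le (fg_genSpace hK hμ) inf_le_left
  have hcomp := (Submodule.fg_iff_compact _).1 hfg
  rw [CompleteLattice.isCompactElement_iff_le_of_directed_sSup_le] at hcomp
  exact hcomp 𝒮 hne hdir fun x hx => by
    obtain ⟨⟨k, hk⟩, hxL⟩ := hx
    exact hpt k x hxL hk

end CompactOperator

section MaximalChain

theorem exists_maximal_chain_in {α : Type*} [PartialOrder α] (p : Set α) {c : Set α} (hc : c ⊆ p)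
    (hchain : IsChain (· ≤ ·) c) :
    ∃ M : Set α, c ⊆ M ∧ M ⊆ p ∧ IsChain (· ≤ ·) M ∧
      ∀ D : Set α, D ⊆ p → IsChain (· ≤ ·) D → M ⊆ D → D = M := by
  have hub : ∀ 𝒮 ⊆ {D : Set α | D ⊆ p ∧ IsChain (· ≤ ·) D}, IsChain (· ⊆ ·) 𝒮 → 𝒮.Nonempty →
      ∃ U ∈ {D : Set α | D ⊆ p ∧ IsChain (· ≤ ·) D}, ∀ D ∈ 𝒮, D ⊆ U := by
    refine fun 𝒮 h𝒮 hch _ => ⟨⋃₀ 𝒮, ⟨Set.sUnion_subset fun D hD => (h𝒮 hD).1, ?_⟩,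
      fun D hD => Set.subset_sUnion_of_mem hD⟩
    rintro a ⟨D₁, h₁, ha⟩ b ⟨D₂, h₂, hb⟩ hab
    rcases hch.total h₁ h₂ with h | h
    · exact (h𝒮 h₂).2 (h ha) hb hab
    · exact (h𝒮 h₁).2 ha (h hb) hab
  obtain ⟨M, hcM, hM⟩ := zorn_subset_nonempty _ hub c ⟨hc, hchain⟩
  exact ⟨M, hcM, hM.prop.1, hM.prop.2, fun D hD hDc hMD => (hM.eq_of_subset ⟨hD, hDc⟩ hMD).symm⟩

theorem mem_of_comparable {α : Type*} [PartialOrder α] {p M : Set α} (hMp : M ⊆ p)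
    (hM : IsChain (· ≤ ·) M) (hmax : ∀ D : Set α, D ⊆ p → IsChain (· ≤ ·) D → M ⊆ D → D = M)
    {a : α} (ha : a ∈ p) (hcomp : ∀ b ∈ M, a ≤ b ∨ b ≤ a) : a ∈ M := by
  rw [← hmax (insert a M) (Set.insert_subset ha hMp) (hM.insert fun b hb _ => hcomp b hb)
    (Set.subset_insert a M)]
  exact Set.mem_insert a M

/-- A pair of adjacent members of a chain. -/
def IsGap {α : Type*} [PartialOrder α] (𝒞 : Set α) (J I : α) : Prop :=
  J ∈ 𝒞 ∧ I ∈ 𝒞 ∧ J < I ∧ ∀ L ∈ 𝒞, L ≤ J ∨ I ≤ L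

theorem IsGap.le_or_le {α : Type*} [PartialOrder α] {𝒞 : Set α} {J I J' I' : α}
    (h : IsGap 𝒞 J I) (h' : IsGap 𝒞 J' I') (hne : (J, I) ≠ (J', I')) : I ≤ J' ∨ I' ≤ J := by
  rcases h'.2.2.2 I h.2.1 with h1 | h1
  · exact Or.inl h1
  rcases h.2.2.2 I' h'.2.1 with h2 | h2
  · exact Or.inr h2
  have hI : I = I' := le_antisymm h2 h1
  rcases h'.2.2.2 J h.1 with h3 | h3
  · rcases h.2.2.2 J' h'.1 with h4 | h4
    · exact absurd (Prod.ext (le_antisymm h3 h4) hI) hne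
    · exact Or.inl h4
  · exact Or.inr h3

end MaximalChain

section Dimension

variable {X : Type*} [NormedAddCommGroup X] [NormedSpace ℝ X]

/-- A chain of closed subspaces that is closed under closed suprema and infima. -/
structure IsCompleteChain (𝒞 : Set (Submodule ℝ X)) : Prop where
  isChain : IsChain (· ≤ ·) 𝒞
  isClosed : ∀ I ∈ 𝒞, IsClosed (I : Set X)
  sSup_mem : ∀ 𝒮 ⊆ 𝒞, 𝒮.Nonempty → (sSup 𝒮).topologicalClosure ∈ 𝒞
  sInf_mem : ∀ 𝒮 ⊆ 𝒞, sInf 𝒮 ∈ 𝒞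

/-- The dimension of the part of a generalized eigenspace that lies in a given subspace. -/
noncomputable def genDim (K : X →L[ℝ] X) (μ : ℝ) (I : Submodule ℝ X) : ℕ :=
  Module.finrank ℝ ↥(genSpace K μ ⊓ I)

variable {K K' : X →L[ℝ] X} {μ : ℝ}

theorem finiteDimensional_genSpace_inf (hK : IsCompactOperator ⇑K) (hμ : μ ≠ 0)
    (I : Submodule ℝ X) : FiniteDimensional ℝ ↥(genSpace K μ ⊓ I) := by
  have := (Submodule.fg_iff_finiteDimensional _).1 (fg_genSpace hK hμ)
  exact Submodule.finiteDimensional_inf_left _ _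

theorem genDim_le_of_inf_le (hK : IsCompactOperator ⇑K) (hμ : μ ≠ 0) {I J : Submodule ℝ X}
    (h : genSpace K μ ⊓ I ≤ J) : genDim K μ I ≤ genDim K μ J := by
  have := finiteDimensional_genSpace_inf hK hμ J
  exact Submodule.finrank_mono (le_inf inf_le_left h)

theorem genDim_mono (hK : IsCompactOperator ⇑K) (hμ : μ ≠ 0) {I J : Submodule ℝ X} (h : I ≤ J) :
    genDim K μ I ≤ genDim K μ J :=
  genDim_le_of_inf_le hK hμ (inf_le_right.trans h)

theorem genDim_eq_add (hK : IsCompactOperator ⇑K) (hμ : μ ≠ 0) {I J : Submodule ℝ X} (h : J ≤ I) :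
    genDim K μ I = genDim K μ J + Module.finrank ℝ ↥((genSpace K μ ⊓ I).map J.mkQ) := by
  have := finiteDimensional_genSpace_inf hK hμ I
  have h1 := LinearMap.finrank_range_add_finrank_ker (J.mkQ.domRestrict (genSpace K μ ⊓ I))
  have h2 : J.comap (genSpace K μ ⊓ I).subtype =
      (genSpace K μ ⊓ J).comap (genSpace K μ ⊓ I).subtype :=
    Submodule.ext fun x => ⟨fun hx => ⟨x.2.1, hx⟩, fun hx => hx.2⟩
  rw [LinearMap.range_domRestrict, LinearMap.ker_domRestrict, Submodule.ker_mkQ, h2,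
    (Submodule.comapSubtypeEquivOfLe (inf_le_inf_left _ h)).finrank_eq] at h1
  rw [genDim, genDim, ← h1, add_comm]

theorem genDim_add_le_of_lift (hK : IsCompactOperator ⇑K) (hK' : IsCompactOperator ⇑K')
    (hμ : μ ≠ 0) {I J : Submodule ℝ X} (h : J ≤ I)
    (hlift : ∀ x ∈ genSpace K μ ⊓ I, ∃ y ∈ genSpace K' μ ⊓ I, x - y ∈ J) :
    genDim K μ I + genDim K' μ J ≤ genDim K' μ I + genDim K μ J := by
  have := finiteDimensional_genSpace_inf hK' hμ I
  rw [genDim_eq_add hK hμ h, genDim_eq_add hK' hμ h]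
  have : Module.finrank ℝ ↥((genSpace K μ ⊓ I).map J.mkQ) ≤
      Module.finrank ℝ ↥((genSpace K' μ ⊓ I).map J.mkQ) := by
    refine Submodule.finrank_mono ?_
    rintro _ ⟨x, hx, rfl⟩
    obtain ⟨y, hy, hxy⟩ := hlift x hx
    exact ⟨y, hy, ((Submodule.Quotient.eq J).2 hxy).symm⟩
  omega

/-- Comparison of the growth of generalized eigenspaces along gaps implies comparison along the
whole chain. -/
theorem IsCompleteChain.genDim_add_le {𝒞 : Set (Submodule ℝ X)} (h𝒞 : IsCompleteChain 𝒞)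
    (hK : IsCompactOperator ⇑K) (hK' : IsCompactOperator ⇑K') (hμ : μ ≠ 0)
    (hinv : ∀ I ∈ 𝒞, ∀ x ∈ I, K x ∈ I)
    (hgap : ∀ J I, IsGap 𝒞 J I →
      genDim K μ I + genDim K' μ J ≤ genDim K' μ I + genDim K μ J)
    {I₁ I₂ : Submodule ℝ X} (h₁ : I₁ ∈ 𝒞) (h₂ : I₂ ∈ 𝒞) (h₁₂ : I₁ ≤ I₂) :
    genDim K μ I₂ + genDim K' μ I₁ ≤ genDim K' μ I₂ + genDim K μ I₁ := by
  induction hn : genDim K μ I₂ - genDim K μ I₁ using Nat.strong_induction_on generalizing I₁ with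
  | _ n ih =>
  have hmono : ∀ {I J : Submodule ℝ X}, I ≤ J → genDim K μ I ≤ genDim K μ J := genDim_mono hK hμ
  have hmono' : ∀ {I J : Submodule ℝ X}, I ≤ J → genDim K' μ I ≤ genDim K' μ J :=
    genDim_mono hK' hμ
  rcases (hmono h₁₂).eq_or_lt with heq | hlt
  · have := hmono' h₁₂
    omega
  set 𝒮 : Set (Submodule ℝ X) := {I | I ∈ 𝒞 ∧ I₁ ≤ I ∧ genDim K μ I ≤ genDim K μ I₁} with h𝒮
  have h𝒮𝒞 : 𝒮 ⊆ 𝒞 := fun I hI => hI.1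
  have h𝒮ne : 𝒮.Nonempty := ⟨I₁, h₁, le_rfl, le_rfl⟩
  set L := (sSup 𝒮).topologicalClosure with hL
  have hL𝒞 : L ∈ 𝒞 := h𝒞.sSup_mem 𝒮 h𝒮𝒞 h𝒮ne
  have hle_L : ∀ I ∈ 𝒮, I ≤ L := fun I hI =>
    (le_sSup hI).trans (Submodule.le_topologicalClosure _)
  have hdL : genDim K μ L ≤ genDim K μ I₁ := by
    obtain ⟨I, hI, hIL⟩ := exists_genSpace_inf_le hK hμ h𝒮ne (h𝒞.isChain.mono h𝒮𝒞)
      (fun I hI => h𝒞.isClosed I hI.1) (fun I hI => hinv I hI.1)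
    exact (genDim_le_of_inf_le hK hμ hIL).trans hI.2.2
  set 𝒯 : Set (Submodule ℝ X) := {I | I ∈ 𝒞 ∧ genDim K μ I₁ < genDim K μ I} with h𝒯
  have h𝒯ne : 𝒯.Nonempty := ⟨I₂, h₂, hlt⟩
  set H := sInf 𝒯 with hH
  have hH𝒞 : H ∈ 𝒞 := h𝒞.sInf_mem 𝒯 fun I hI => hI.1
  have hdH : genDim K μ I₁ < genDim K μ H := by
    obtain ⟨I, hI, hmin⟩ := (InvImage.wf (genDim K μ) wellFounded_lt).has_min 𝒯 h𝒯ne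
    refine hI.2.trans_le (genDim_le_of_inf_le hK hμ (le_sInf fun I' hI' => ?_))
    rcases h𝒞.isChain.total hI.1 hI'.1 with h | h
    · exact inf_le_right.trans h
    · have := finiteDimensional_genSpace_inf hK hμ I
      have h1 : genSpace K μ ⊓ I' = genSpace K μ ⊓ I :=
        Submodule.eq_of_le_of_finrank_le (inf_le_inf_left _ h) (not_lt.1 (hmin I' hI'))
      rw [← h1]
      exact inf_le_right
  have hLH : L < H := by
    refine lt_of_le_of_ne (le_sInf fun I hI => ?_) fun h => ?_
    · rcases h𝒞.isChain.total hL𝒞 hI.1 with h | h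
      · exact h
      · have := hmono h
        have := hI.2
        omega
    · rw [← h] at hdH
      omega
  have hLHgap : IsGap 𝒞 L H := ⟨hL𝒞, hH𝒞, hLH, fun Q hQ => by
    rcases le_or_gt (genDim K μ Q) (genDim K μ I₁) with h | h
    · left
      rcases h𝒞.isChain.total hQ h₁ with h' | h'
      · exact h'.trans (hle_L I₁ ⟨h₁, le_rfl, le_rfl⟩)
      · exact hle_L Q ⟨hQ, h', h⟩
    · exact Or.inr (sInf_le ⟨hQ, h⟩)⟩
  have hHI₂ : H ≤ I₂ := sInf_le ⟨h₂, hlt⟩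
  have e1 := hmono' (hle_L I₁ ⟨h₁, le_rfl, le_rfl⟩)
  have e2 := hgap L H hLHgap
  have e3 := hmono hHI₂
  have e4 := ih (genDim K μ I₂ - genDim K μ H) (by omega) hH𝒞 hHI₂ rfl
  omega

end Dimension

section GapGrowth

variable {X : Type*} [NormedAddCommGroup X] [NormedSpace ℝ X] {I J : Submodule ℝ X}

theorem pow_sub_pow_mem {P Q : X →L[ℝ] X} (hP : ∀ x ∈ J, P x ∈ J) (hQ : ∀ x ∈ I, Q x ∈ I)
    (h : ∀ x ∈ I, P x - Q x ∈ J) (m : ℕ) : ∀ x ∈ I, (P ^ m) x - (Q ^ m) x ∈ J := by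
  induction m with
  | zero => exact fun x _ => by simp
  | succ m ih =>
    intro x hx
    have h1 := J.add_mem (pow_apply_mem hP m _ (h x hx)) (ih _ (hQ x hx))
    rwa [map_sub, sub_add_sub_cancel] at h1

theorem pow_apply_sub_mem {S : X →L[ℝ] X} (hS : ∀ x ∈ J, S x ∈ J) {c : ℝ} {u : X}
    (hu : S u - c • u ∈ J) (m : ℕ) : (S ^ m) u - c ^ m • u ∈ J := by
  have h1 := pow_sub_pow_mem (I := Submodule.span ℝ {u}) (Q := c • (1 : X →L[ℝ] X)) hS
    (fun x hx => Submodule.smul_mem _ c hx) (fun x hx => by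
      obtain ⟨a, rfl⟩ := Submodule.mem_span_singleton.1 hx
      have := J.smul_mem a hu
      rwa [smul_sub, ← map_smul, smul_comm] at this) m u (Submodule.mem_span_singleton_self u)
  rwa [smul_pow, one_pow] at h1

variable {K K' : X →L[ℝ] X} {μ : ℝ}

/-- If two compact operators agree on `I` modulo `J`, then so do their generalized eigenspaces. -/
theorem genDim_add_le_of_agree [CompleteSpace X] (hK : IsCompactOperator ⇑K)
    (hK' : IsCompactOperator ⇑K') (hμ : μ ≠ 0) (hJ : IsClosed (J : Set X)) (hJI : J ≤ I)
    (hKI : ∀ x ∈ I, K x ∈ I) (hKJ' : ∀ x ∈ J, K' x ∈ J) (h : ∀ x ∈ I, K' x - K x ∈ J) :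
    genDim K μ I + genDim K' μ J ≤ genDim K' μ I + genDim K μ J := by
  refine genDim_add_le_of_lift hK hK' hμ hJI ?_
  rintro x ⟨⟨k, hk⟩, hxI⟩
  have h1 : ((K' - μ • 1) ^ k) x ∈ J := by
    have := pow_sub_pow_mem (P := K' - μ • 1) (Q := K - μ • 1) (sub_smul_one_mem hKJ')
      (sub_smul_one_mem hKI) (fun z hz => by
        rw [sub_smul_one_apply, sub_smul_one_apply, sub_sub_sub_cancel_right]
        exact h z hz) k x hxI
    rwa [hk, sub_zero] at this
  obtain ⟨j, hj, hxj⟩ := exists_sub_mem_genSpace_of_pow_mem hK' hμ hJ hKJ' h1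
  exact ⟨x - j, ⟨hxj, I.sub_mem hxI (hJI hj)⟩, by rwa [sub_sub_cancel]⟩

theorem genDim_le_of_injective_mod (hK : IsCompactOperator ⇑K) (hμ : μ ≠ 0)
    (hKI : ∀ x ∈ I, K x ∈ I) (h : ∀ x ∈ I, K x - μ • x ∈ J → x ∈ J) :
    genDim K μ I ≤ genDim K μ J := by
  refine genDim_le_of_inf_le hK hμ ?_
  rintro x ⟨⟨k, hk⟩, hxI⟩
  induction k generalizing x with
  | zero =>
    rw [show x = 0 from hk]
    exact J.zero_mem
  | succ k ih => exact h x hxI (ih (sub_smul_one_mem hKI x hxI) hk)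

theorem genDim_lt_of_eigenvector_mod [CompleteSpace X] (hK : IsCompactOperator ⇑K) (hμ : μ ≠ 0)
    (hJ : IsClosed (J : Set X)) (hJI : J ≤ I) (hKJ : ∀ x ∈ J, K x ∈ J) {u : X} (hu : u ∈ I)
    (huJ : u ∉ J) (h : K u - μ • u ∈ J) : genDim K μ J < genDim K μ I := by
  obtain ⟨j, hj, huj⟩ := exists_sub_mem_genSpace_of_pow_mem (k := 1) hK hμ hJ hKJ
    (x := u) (by rwa [pow_one])
  have := finiteDimensional_genSpace_inf hK hμ I
  refine Submodule.finrank_lt_finrank_of_lt (lt_of_le_of_ne (inf_le_inf_left _ hJI) fun heq => ?_)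
  have h1 : u - j ∈ genSpace K μ ⊓ J := by
    rw [heq]
    exact ⟨huj, I.sub_mem hu (hJI hj)⟩
  exact huJ (by simpa using J.add_mem h1.2 hj)

theorem mul_pow_succ_comm (A B : X →L[ℝ] X) (n : ℕ) : (B * A) ^ (n + 1) = B * (A * B) ^ n * A := by
  induction n with
  | zero => simp
  | succ n ih => rw [pow_succ, ih, pow_succ]; simp only [mul_assoc]

/-- The nonzero generalized eigenvalues of powers of `A B` are dominated by those of `B A`. -/
theorem genDim_top_le (A B : X →L[ℝ] X) {N : ℕ} (hN : 1 ≤ N)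
    (hK : IsCompactOperator ⇑((B * A) ^ N)) (hμ : μ ≠ 0) :
    genDim ((A * B) ^ N) μ ⊤ ≤ genDim ((B * A) ^ N) μ ⊤ := by
  have hcomm : ∀ (k : ℕ) (x : X),
      (((B * A) ^ N - μ • 1) ^ k) (B x) = B ((((A * B) ^ N - μ • 1) ^ k) x) := by
    have h1 : SemiconjBy B ((A * B) ^ N - μ • 1) ((B * A) ^ N - μ • 1) := by
      refine SemiconjBy.sub_right (SemiconjBy.pow_right (mul_assoc B A B).symm N) ?_
      exact (Commute.one_right B).smul_right μ
    exact fun k x => congrArg (fun V : X →L[ℝ] X => V x) (h1.pow_right k).symm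
  have hmem : ∀ x ∈ genSpace ((A * B) ^ N) μ ⊓ ⊤, B x ∈ genSpace ((B * A) ^ N) μ ⊓ ⊤ := by
    rintro x ⟨⟨k, hk⟩, -⟩
    exact ⟨⟨k, by rw [hcomm, hk, map_zero]⟩, trivial⟩
  have := finiteDimensional_genSpace_inf hK hμ ⊤
  refine LinearMap.finrank_le_finrank_of_injective (f := (B : X →ₗ[ℝ] X).restrict hmem) ?_
  rw [injective_iff_map_eq_zero]
  rintro ⟨x, ⟨k, hk⟩, hx⟩ hBx
  have hB : B x = 0 := congrArg Subtype.val hBx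
  have hS : ((A * B) ^ N) x = 0 := by
    obtain ⟨m, rfl⟩ := Nat.exists_eq_add_of_le' hN
    rw [pow_succ, mul_apply_eq_comp, mul_apply_eq_comp, hB, map_zero, map_zero]
  have h1 : ∀ l : ℕ, (((A * B) ^ N - μ • 1) ^ l) x = (-μ) ^ l • x := by
    intro l
    induction l with
    | zero => simp
    | succ l ih => rw [pow_succ, mul_apply_eq_comp, sub_smul_one_apply, hS, zero_sub, map_neg,
        map_smul, ih, pow_succ', neg_mul, neg_smul, mul_smul]
  rw [h1] at hk
  exact Subtype.ext ((smul_eq_zero.1 hk).resolve_left (pow_ne_zero _ (neg_ne_zero.2 hμ)))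

end GapGrowth

section InvariantChain

variable {E : Type*} [NormedAddCommGroup E] [Lattice E] [HasSolidNorm E] [IsOrderedAddMonoid E]
  [NormedSpace ℝ E] {A B S R : E →L[ℝ] E} {𝒞 : Set (Submodule ℝ E)}

/-- A maximal chain of closed ideals invariant under an operator. -/
structure IsMaximalInvariantChain (S : E →L[ℝ] E) (𝒞 : Set (Submodule ℝ E)) : Prop where
  isClosedIdeal : ∀ I ∈ 𝒞, IsClosedIdeal I
  invariantUnder : ∀ I ∈ 𝒞, InvariantUnder S I
  isChain : IsChain (· ≤ ·) 𝒞
  mem : ∀ L, IsClosedIdeal L → InvariantUnder S L → (∀ I ∈ 𝒞, L ≤ I ∨ I ≤ L) → L ∈ 𝒞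

theorem exists_isMaximalInvariantChain (S : E →L[ℝ] E) : ∃ 𝒞, IsMaximalInvariantChain S 𝒞 := by
  obtain ⟨𝒞, -, hp, hch, hmax⟩ := exists_maximal_chain_in
    {I : Submodule ℝ E | IsClosedIdeal I ∧ InvariantUnder S I} (Set.empty_subset _) IsChain.empty
  exact ⟨𝒞, fun I hI => (hp hI).1, fun I hI => (hp hI).2, hch, fun L hL hLS hcomp =>
    mem_of_comparable hp hch hmax ⟨hL, hLS⟩ hcomp⟩

namespace IsMaximalInvariantChain

theorem bot_mem (h : IsMaximalInvariantChain S 𝒞) : ⊥ ∈ 𝒞 := by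
  refine h.mem ⊥ ⟨by simp, fun x y hxy hy => ?_⟩ (fun x hx => ?_)
    fun I _ => Or.inl bot_le
  · rw [Submodule.mem_bot] at hy ⊢
    exact eq_zero_of_abs_nonpos (by simpa [hy] using hxy)
  · rw [Submodule.mem_bot] at hx ⊢
    rw [hx, map_zero]

theorem top_mem (h : IsMaximalInvariantChain S 𝒞) : ⊤ ∈ 𝒞 :=
  h.mem ⊤ ⟨isClosed_univ, fun _ _ _ _ => trivial⟩ (fun _ _ => trivial) fun _ _ => Or.inr le_top

theorem isCompleteChain (h : IsMaximalInvariantChain S 𝒞) : IsCompleteChain 𝒞 where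
  isChain := h.isChain
  isClosed I hI := (h.isClosedIdeal I hI).1
  sSup_mem 𝒮 h𝒮 hne := by
    have hmem : ∀ x, x ∈ sSup 𝒮 ↔ ∃ I ∈ 𝒮, x ∈ I := fun x =>
      Submodule.mem_sSup_of_directed hne (h.isChain.mono h𝒮).directedOn
    refine h.mem _ (isClosedIdeal_topologicalClosure fun x y hxy hy => ?_) (fun x hx => ?_)
      fun I hI => ?_
    · obtain ⟨I, hI, hyI⟩ := (hmem y).1 hy
      exact (hmem x).2 ⟨I, hI, (h.isClosedIdeal I (h𝒮 hI)).2 x y hxy hyI⟩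
    · refine map_mem_closure S.continuous hx fun z hz => ?_
      obtain ⟨I, hI, hzI⟩ := (hmem z).1 hz
      exact (hmem _).2 ⟨I, hI, h.invariantUnder I (h𝒮 hI) z hzI⟩
    · by_cases hub : ∀ Q ∈ 𝒮, Q ≤ I
      · exact Or.inl (Submodule.topologicalClosure_minimal _ (sSup_le hub)
          (h.isClosedIdeal I hI).1)
      · push Not at hub
        obtain ⟨Q, hQ, hQI⟩ := hub
        exact Or.inr (((h.isChain.total (h𝒮 hQ) hI).resolve_left hQI).trans
          ((le_sSup hQ).trans (Submodule.le_topologicalClosure _)))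
  sInf_mem 𝒮 h𝒮 := by
    refine h.mem _ ⟨?_, fun x y hxy hy => ?_⟩ (fun x hx => ?_) fun I hI => ?_
    · rw [Submodule.coe_sInf]
      exact isClosed_biInter fun I hI => (h.isClosedIdeal I (h𝒮 hI)).1
    · rw [Submodule.mem_sInf] at hy ⊢
      exact fun I hI => (h.isClosedIdeal I (h𝒮 hI)).2 x y hxy (hy I hI)
    · rw [Submodule.mem_sInf] at hx ⊢
      exact fun I hI => h.invariantUnder I (h𝒮 hI) x (hx I hI)
    · by_cases hlb : ∀ Q ∈ 𝒮, I ≤ Q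
      · exact Or.inr (le_sInf hlb)
      · push Not at hlb
        obtain ⟨Q, hQ, hQI⟩ := hlb
        exact Or.inl ((sInf_le hQ).trans ((h.isChain.total (h𝒮 hQ) hI).resolve_right hQI))

theorem eq_or_eq_of_isGap (h : IsMaximalInvariantChain S 𝒞) {J I : Submodule ℝ E}
    (hg : IsGap 𝒞 J I) {L : Submodule ℝ E} (hL : IsClosedIdeal L) (hLS : InvariantUnder S L)
    (hJL : J ≤ L) (hLI : L ≤ I) : L = J ∨ L = I := by
  have hLC : L ∈ 𝒞 := h.mem L hL hLS fun Q hQ =>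
    (hg.2.2.2 Q hQ).symm.imp hLI.trans fun h' => h'.trans hJL
  exact (hg.2.2.2 L hLC).imp (fun h' => le_antisymm h' hJL) fun h' => le_antisymm hLI h'

/-- Every closed ideal comparable with a maximal invariant chain is either a member of the chain
or fits into one of its gaps. -/
theorem mem_or_exists_isGap (h : IsMaximalInvariantChain S 𝒞) {L : Submodule ℝ E}
    (hL : IsClosed (L : Set E)) (hcomp : ∀ I ∈ 𝒞, L ≤ I ∨ I ≤ L) :
    L ∈ 𝒞 ∨ ∃ J I, IsGap 𝒞 J I ∧ J ≤ L ∧ L ≤ I := by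
  set J := (sSup {I | I ∈ 𝒞 ∧ I ≤ L}).topologicalClosure with hJ
  set H := sInf {I | I ∈ 𝒞 ∧ L ≤ I} with hH
  have hJC : J ∈ 𝒞 := h.isCompleteChain.sSup_mem _ (fun I hI => hI.1) ⟨⊥, h.bot_mem, bot_le⟩
  have hHC : H ∈ 𝒞 := h.isCompleteChain.sInf_mem _ fun I hI => hI.1
  have hJL : J ≤ L := Submodule.topologicalClosure_minimal _ (sSup_le fun I hI => hI.2) hL
  have hLH : L ≤ H := le_sInf fun I hI => hI.2
  rcases (hJL.trans hLH).eq_or_lt with heq | hlt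
  · left
    rwa [le_antisymm (heq ▸ hLH) hJL]
  · refine Or.inr ⟨J, H, ⟨hJC, hHC, hlt, fun Q hQ => ?_⟩, hJL, hLH⟩
    rcases hcomp Q hQ with h1 | h1
    · exact Or.inr (sInf_le ⟨hQ, h1⟩)
    · exact Or.inl ((le_sSup (show Q ∈ {I | I ∈ 𝒞 ∧ I ≤ L} from ⟨hQ, h1⟩)).trans
        (Submodule.le_topologicalClosure _))

/-- Along infinitely many distinct gaps the eigenvalues of an operator with a compact power cannot
stay away from zero. -/
theorem not_exists_gap_sequence (h : IsMaximalInvariantChain S 𝒞) {N : ℕ}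
    (hN : IsCompactOperator ⇑(S ^ N)) {g : ℕ → Submodule ℝ E × Submodule ℝ E} {lam : ℕ → ℝ}
    (hg : ∀ n, IsGap 𝒞 (g n).1 (g n).2) (hinj : Function.Injective g) {ε : ℝ} (hε : 0 < ε)
    (hlam : ∀ n, ε ≤ lam n)
    (hu : ∀ n, ∃ u ∈ (g n).2, u ∉ (g n).1 ∧ S u - lam n • u ∈ (g n).1) : False := by
  have key : ∀ n, ∃ y ∈ (g n).2, ‖y‖ ≤ 2 ∧ (∀ i ∈ (g n).1, 1 ≤ ‖y - i‖) ∧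
      (S ^ N) y - lam n ^ N • y ∈ (g n).1 := by
    intro n
    obtain ⟨u, huI, huJ, hSu⟩ := hu n
    have hSJ := h.invariantUnder _ (hg n).1
    obtain ⟨c, j, hj, hn, hd⟩ := exists_riesz (h.isClosedIdeal _ (hg n).1).1 huJ
    refine ⟨c • (u - j), Submodule.smul_mem _ _ (Submodule.sub_mem _ huI ((hg n).2.2.1.le hj)),
      hn, hd, pow_apply_sub_mem hSJ ?_ N⟩
    have h1 : S (c • (u - j)) - lam n • c • (u - j) =
        c • ((S u - lam n • u) - (S j - lam n • j)) := by
      rw [map_smul, map_sub, smul_comm (lam n), ← smul_sub, smul_sub (lam n)]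
      congr 1
      abel
    rw [h1]
    exact Submodule.smul_mem _ _ (Submodule.sub_mem _ hSu
      (Submodule.sub_mem _ (hSJ j hj) (Submodule.smul_mem _ _ hj)))
  choose y hyI hy2 hyJ hyK using key
  refine not_exists_separated hN (pow_pos hε N) (fun n => ?_) hy2 hyJ hyK fun m n hmn => ?_
  · rw [abs_of_nonneg (pow_nonneg (hε.le.trans (hlam n)) N)]
    exact pow_le_pow_left₀ hε.le (hlam n) N
  · refine ((hg m).le_or_le (hg n) (hinj.ne hmn)).imp (fun h' => h' ?_) (fun h' => h' ?_)
    · exact pow_apply_mem (h.invariantUnder _ (hg m).2.1) N _ (hyI m)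
    · exact pow_apply_mem (h.invariantUnder _ (hg n).2.1) N _ (hyI n)

/-- The commutator `A B - B A` maps the upper end of each gap into its lower end. -/
theorem commutator_apply_mem_of_isGap [CompleteSpace E]
    (h : IsMaximalInvariantChain (A * B) 𝒞) (hBA : IsPos (B * A)) (hC : IsPos (A * B - B * A))
    {n : ℕ} (hn : IsCompactOperator ⇑((A * B) ^ n)) {J I : Submodule ℝ E} (hg : IsGap 𝒞 J I) :
    ∀ x ∈ I, (A * B - B * A) x ∈ J := by
  by_contra! hbad
  set N := n + 1 with hN
  have hN1 : 1 ≤ N := Nat.le_add_left 1 n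
  have hKS : IsCompactOperator ⇑((A * B) ^ N) := by
    rw [hN, pow_succ]
    exact hn.comp_clm (A * B)
  have hKR : IsCompactOperator ⇑((B * A) ^ N) := by
    rw [hN, mul_pow_succ_comm]
    exact (hn.clm_comp B).comp_clm A
  have hR : ∀ L ∈ 𝒞, InvariantUnder (B * A) L := fun L hL =>
    (h.isClosedIdeal L hL).invariantUnder_of_le hBA hC (h.invariantUnder L hL)
  set bad : Set (Submodule ℝ E × Submodule ℝ E) :=
    {g | IsGap 𝒞 g.1 g.2 ∧ ∃ x ∈ g.2, (A * B - B * A) x ∉ g.1} with hbad_def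
  have key : ∀ g : bad, ∃ lam : ℝ, 0 < lam ∧
      (∃ u ∈ g.1.2, u ∉ g.1.1 ∧ (A * B) u - lam • u ∈ g.1.1) ∧
      ∀ μ, lam ^ N ≤ μ → ∀ x ∈ g.1.2, ((B * A) ^ N) x - μ • x ∈ g.1.1 → x ∈ g.1.1 := by
    rintro ⟨g, hg, hne⟩
    exact exists_eigenvalue_of_gap hBA hC (h.isClosedIdeal _ hg.2.1) (h.isClosedIdeal _ hg.1)
      hg.2.2.1.le (h.invariantUnder _ hg.2.1) (h.invariantUnder _ hg.1)
      (fun L hL hLS => h.eq_or_eq_of_isGap hg hL hLS) hne hN1 hKS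
  choose lam hlam0 hlamu hlamR using key
  obtain ⟨g, hmax⟩ : ∃ g : bad, ∀ g', lam g' ≤ lam g := by
    by_contra! hno
    choose next hnext using hno
    set s : ℕ → bad := fun k => next^[k] ⟨(J, I), hg, hbad⟩ with hs
    have hmono : StrictMono (fun k => lam (s k)) := strictMono_nat_of_lt_succ fun k => by
      simp only [hs, Function.iterate_succ_apply']
      exact hnext _
    exact h.not_exists_gap_sequence hKS (g := fun k => (s k).1) (lam := fun k => lam (s k))
      (fun k => (s k).2.1) (fun k l hkl => hmono.injective (congrArg lam (Subtype.ext hkl)))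
      (hlam0 (s 0)) (fun k => hmono.monotone (Nat.zero_le k)) (fun k => hlamu (s k))
  set μ := lam g ^ N with hμ
  have hμ0 : μ ≠ 0 := (pow_pos (hlam0 g) N).ne'
  have hgap : ∀ J I, IsGap 𝒞 J I → genDim ((B * A) ^ N) μ I + genDim ((A * B) ^ N) μ J ≤
      genDim ((A * B) ^ N) μ I + genDim ((B * A) ^ N) μ J := by
    intro J I hJI
    by_cases hne : ∃ x ∈ I, (A * B - B * A) x ∉ J
    · have h1 := genDim_mono hKS hμ0 hJI.2.2.1.le
      have h2 : genDim ((B * A) ^ N) μ I ≤ genDim ((B * A) ^ N) μ J :=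
        genDim_le_of_injective_mod hKR hμ0 (pow_apply_mem (hR I hJI.2.1) N)
        (hlamR ⟨(J, I), hJI, hne⟩ μ (pow_le_pow_left₀ (hlam0 _).le (hmax _) N))
      omega
    · push Not at hne
      exact genDim_add_le_of_agree hKR hKS hμ0 (h.isClosedIdeal _ hJI.1).1 hJI.2.2.1.le
        (pow_apply_mem (hR I hJI.2.1) N) (pow_apply_mem (h.invariantUnder J hJI.1) N)
        (pow_sub_pow_mem (h.invariantUnder J hJI.1) (hR I hJI.2.1) hne N)
  obtain ⟨⟨J', I'⟩, hg', hne'⟩ := g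
  have hcmp := fun {I₁ I₂} => h.isCompleteChain.genDim_add_le (I₁ := I₁) (I₂ := I₂) hKR hKS hμ0
    (fun L hL => pow_apply_mem (hR L hL) N) hgap
  have e1 := hcmp (I₂ := J') h.bot_mem hg'.1 bot_le
  have e2 := hcmp (I₁ := I') hg'.2.1 h.top_mem le_top
  have e3 := genDim_top_le A B hN1 hKR hμ0
  have e4 : genDim ((B * A) ^ N) μ I' ≤ genDim ((B * A) ^ N) μ J' :=
    genDim_le_of_injective_mod hKR hμ0 (pow_apply_mem (hR I' hg'.2.1) N) (hlamR _ μ le_rfl)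
  have e5 : genDim ((A * B) ^ N) μ J' < genDim ((A * B) ^ N) μ I' := by
    obtain ⟨u, huI, huJ, hu⟩ := hlamu ⟨(J', I'), hg', hne'⟩
    exact genDim_lt_of_eigenvector_mod hKS hμ0 (h.isClosedIdeal _ hg'.1).1 hg'.2.2.1.le
      (pow_apply_mem (h.invariantUnder J' hg'.1) N) huI huJ
      (pow_apply_sub_mem (h.invariantUnder J' hg'.1) hu N)
  have e6 : ∀ K : E →L[ℝ] E, genDim K μ ⊥ = 0 := fun K => by
    rw [genDim, inf_bot_eq, finrank_bot]
  rw [e6, e6] at e1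
  omega

end IsMaximalInvariantChain
end InvariantChain

end BanachLattice

/-- If `A B ≥ B A ≥ 0` on a Banach lattice `E` and `A B` is power-compact, then
the commutator `C = A B - B A` is ideal-triangularizable: there is a chain of closed ideals,
each invariant under `C`, which is maximal as a chain in the lattice of all closed ideals. -/
theorem stmt1 {E : Type*} [NormedAddCommGroup E] [Lattice E] [HasSolidNorm E] [IsOrderedAddMonoid E] [NormedSpace ℝ E] [CompleteSpace E]
    (A B : E →L[ℝ] E)
    (hBA : ∀ x : E, 0 ≤ x → 0 ≤ (B * A) x)
    (hC : ∀ x : E, 0 ≤ x → 0 ≤ (A * B - B * A) x)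
    (hAB : ∃ n : ℕ, 1 ≤ n ∧ IsCompactOperator ⇑((A * B) ^ n)) :
    ∃ 𝒞 : Set (Submodule ℝ E),
      (∀ I ∈ 𝒞, IsClosedIdeal I) ∧
      (∀ I ∈ 𝒞, InvariantUnder (A * B - B * A) I) ∧
      IsChain (· ≤ ·) 𝒞 ∧
      (∀ 𝒟 : Set (Submodule ℝ E), (∀ I ∈ 𝒟, IsClosedIdeal I) → IsChain (· ≤ ·) 𝒟 →
        𝒞 ⊆ 𝒟 → 𝒟 = 𝒞) := by
  obtain ⟨n, -, hn⟩ := hAB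
  obtain ⟨𝒞, h𝒞⟩ := BanachLattice.exists_isMaximalInvariantChain (A * B)
  obtain ⟨M, hCM, hM, hchain, hmax⟩ := BanachLattice.exists_maximal_chain_in
    {I : Submodule ℝ E | IsClosedIdeal I} h𝒞.isClosedIdeal h𝒞.isChain
  refine ⟨M, hM, fun L hL => ?_, hchain, hmax⟩
  rcases h𝒞.mem_or_exists_isGap (hM hL).1 fun I hI => hchain.total hL (hCM hI) with h | h
  · have hRC : BanachLattice.IsPos (A * B - (A * B - B * A)) := by rwa [sub_sub_cancel]
    exact (hM hL).invariantUnder_of_le hC hRC (h𝒞.invariantUnder L h)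
  · obtain ⟨J, I, hg, hJL, hLI⟩ := h
    exact fun x hx => hJL (h𝒞.commutator_apply_mem_of_isGap hBA hC hn hg x (hLI hx))
end

section
/- Let A and B be bounded linear operators on a Banach lattice E such that AB ≥ BA ≥ 0 (i.e., BA is a positive operator and AB − BA is a positive operator) and AB is a power-compact operator. Then both the product BA and the commutator C = AB − BA are power-compact operators. -/
universe u

/-- A two-argument function `d` is finitely discretizable on `s` if for each `ε > 0` there is a
finite colouring such that `d ≤ ε` on pairs of points of `s` with the same colour. -/
def FinitelyDiscretizable {E : Type u} (s : Set E) (d : E → E → ℝ) : Prop :=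
  ∀ ε : ℝ, 0 < ε → ∃ (α : Type u) (_ : Finite α) (c : E → α),
    ∀ x ∈ s, ∀ y ∈ s, c x = c y → d x y ≤ ε

/-- The quadratic energy of the matrix `f j (S (v i))` relative to `f j (K (v i))`. -/
noncomputable def relativeEnergy {E ι κ : Type*} [NormedAddCommGroup E] [NormedSpace ℝ E]
    [Fintype ι] [Fintype κ] (S K : E →L[ℝ] E) (v : ι → E) (f : κ → E →ₗ[ℝ] ℝ) : ℝ :=
  ∑ i, ∑ j, (f j (S (v i))) ^ 2 / f j (K (v i))

/-- Splitting a cell into four pieces increases the energy by at least the contribution of the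
first piece. -/
theorem sq_div_add_sq_div_le_of_split {a b : Fin 4 → ℝ} (ha : ∀ i, 0 ≤ a i)
    (hab : ∀ i, a i ≤ b i) :
    (∑ i, a i) ^ 2 / (∑ i, b i) + (a 0 - (∑ i, a i) / (∑ i, b i) * b 0) ^ 2 / b 0 ≤
      ∑ i, (a i) ^ 2 / b i := by
  set s := ∑ i, a i with hs
  set t := ∑ i, b i with ht
  have hb : ∀ i, 0 ≤ b i := fun i => (ha i).trans (hab i)
  have hst : s ≤ t := Finset.sum_le_sum fun i _ => hab i
  have hs0 : 0 ≤ s := Finset.sum_nonneg fun i _ => ha i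
  have key : ∀ (h x y : ℝ), 0 ≤ x → x ≤ y →
      x ^ 2 / y = 2 * h * x - h ^ 2 * y + (x - h * y) ^ 2 / y := by
    intro h x y hx hxy
    rcases eq_or_ne y 0 with rfl | hy
    · have : x = 0 := le_antisymm hxy hx
      simp [this]
    · field_simp
      ring
  have hS : ∑ i, (a i) ^ 2 / b i =
      2 * (s / t) * s - (s / t) ^ 2 * t + ∑ i, (a i - s / t * b i) ^ 2 / b i := by
    rw [Finset.sum_congr rfl fun i _ => key (s / t) (a i) (b i) (ha i) (hab i),
      Finset.sum_add_distrib, Finset.sum_sub_distrib, ← Finset.mul_sum, ← Finset.mul_sum]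
  have h0 : s ^ 2 / t = 2 * (s / t) * s - (s / t) ^ 2 * t := by
    rcases eq_or_ne t 0 with h | h
    · simp [h]
    · field_simp
      ring
  rw [hS, h0]
  gcongr
  exact Finset.single_le_sum (f := fun i => (a i - s / t * b i) ^ 2 / b i)
    (fun i _ => div_nonneg (sq_nonneg _) (hb i)) (Finset.mem_univ 0)

/-- A sublinear functional is attained at any given point by a linear functional below it. -/
theorem exists_linear_le_sublinear {E : Type*} [AddCommGroup E] [Module ℝ E] (p : E → ℝ)
    (p_hom : ∀ c : ℝ, 0 < c → ∀ x, p (c • x) = c * p x) (p_add : ∀ x y, p (x + y) ≤ p x + p y)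
    (y : E) : ∃ f : E →ₗ[ℝ] ℝ, f y = p y ∧ ∀ x, f x ≤ p x := by
  have p0 : p 0 = 0 := by
    have := p_hom 2 two_pos 0
    rw [smul_zero] at this
    linarith
  have H : ∀ c : ℝ, c • y = 0 → (RingHom.id ℝ) c • p y = 0 := by
    intro c hc
    rcases smul_eq_zero.1 hc with rfl | rfl
    · simp
    · simp [p0]
  obtain ⟨g, hg, hgp⟩ := exists_extension_of_le_sublinear (LinearPMap.mkSpanSingleton' y (p y) H)
    p p_hom p_add (by
      rintro ⟨x, hx⟩
      obtain ⟨c, rfl⟩ := Submodule.mem_span_singleton.1 hx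
      rw [LinearPMap.mkSpanSingleton'_apply]
      simp only [RingHom.id_apply, smul_eq_mul]
      rcases lt_trichotomy c 0 with hc | rfl | hc
      · have h1 := p_add (c • y) ((-c) • y)
        rw [p_hom (-c) (neg_pos.2 hc), ← add_smul, add_neg_cancel, zero_smul, p0] at h1
        linarith
      · simp [p0]
      · rw [p_hom c hc])
  refine ⟨g, ?_, hgp⟩
  exact (hg ⟨y, Submodule.mem_span_singleton_self y⟩).trans
    (LinearPMap.mkSpanSingleton'_apply_self y (p y) H _)

section NormedLattice

variable {E : Type u} [NormedAddCommGroup E] [Lattice E] [HasSolidNorm E] [IsOrderedAddMonoid E]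
  [NormedSpace ℝ E]

theorem smul_nonneg_of_hasSolidNorm {r : ℝ} (hr : 0 ≤ r) {x : E} (hx : 0 ≤ x) : 0 ≤ r • x := by
  have half : ∀ y : E, 0 ≤ y → 0 ≤ (2⁻¹ : ℝ) • y := by
    intro y hy
    refine nsmul_two_semiclosed ?_
    rw [← Nat.cast_smul_eq_nsmul ℝ, smul_smul]
    simpa using hy
  have pow : ∀ n : ℕ, 0 ≤ ((2 : ℝ) ^ n)⁻¹ • x := by
    intro n
    induction n with
    | zero => simpa using hx
    | succ n ih =>
      have := half _ ih
      rwa [smul_smul, ← mul_inv, ← pow_succ'] at this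
  have lim : Filter.Tendsto (fun n : ℕ => ((⌊r * 2 ^ n⌋₊ : ℝ) / 2 ^ n) • x) Filter.atTop
      (nhds (r • x)) :=
    ((tendsto_nat_floor_mul_div_atTop hr).comp
      (tendsto_pow_atTop_atTop_of_one_lt (one_lt_two : (1 : ℝ) < 2))).smul_const x
  refine ge_of_tendsto' lim fun n => ?_
  rw [div_eq_mul_inv, mul_smul, Nat.cast_smul_eq_nsmul]
  exact nsmul_nonneg (pow n) _

theorem posPart_smul_of_pos {r : ℝ} (hr : 0 < r) (x : E) : (r • x)⁺ = r • x⁺ := by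
  have mono : ∀ {s : ℝ} {y z : E}, 0 < s → y ≤ z → s • y ≤ s • z := by
    intro s y z hs h
    have := smul_nonneg_of_hasSolidNorm hs.le (sub_nonneg.2 h)
    rwa [smul_sub, sub_nonneg] at this
  apply le_antisymm
  · exact sup_le (mono hr (le_posPart x)) (smul_nonneg_of_hasSolidNorm hr.le (posPart_nonneg x))
  · have : x⁺ ≤ r⁻¹ • (r • x)⁺ := by
      refine sup_le ?_ (smul_nonneg_of_hasSolidNorm (inv_pos.2 hr).le (posPart_nonneg _))
      have := mono (inv_pos.2 hr) (le_posPart (r • x))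
      rwa [smul_smul, inv_mul_cancel₀ hr.ne', one_smul] at this
    have := mono hr this
    rwa [smul_smul, mul_inv_cancel₀ hr.ne', one_smul] at this

theorem posPart_add_le_add {E : Type*} [AddCommGroup E] [Lattice E] [IsOrderedAddMonoid E] (x y : E)
    : (x + y)⁺ ≤ x⁺ + y⁺ :=
  sup_le (add_le_add (le_posPart x) (le_posPart y))
    (add_nonneg (posPart_nonneg x) (posPart_nonneg y))

theorem norm_le_norm_of_nonneg_of_le {E : Type*} [NormedAddCommGroup E] [Lattice E] [HasSolidNorm E]
    [IsOrderedAddMonoid E] {x y : E} (hx : 0 ≤ x) (hxy : x ≤ y) : ‖x‖ ≤ ‖y‖ :=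
  norm_le_norm_of_abs_le_abs (by rwa [abs_of_nonneg hx, abs_of_nonneg (hx.trans hxy)])

theorem norm_posPart_le_norm {E : Type*} [NormedAddCommGroup E] [Lattice E] [HasSolidNorm E]
    [IsOrderedAddMonoid E] (x : E) : ‖x⁺‖ ≤ ‖x‖ :=
  norm_le_norm_of_abs_le_abs (by
    rw [abs_of_nonneg (posPart_nonneg x)]
    exact sup_le (le_abs_self x) (abs_nonneg x))

/-- Riesz decomposition property. -/
theorem exists_riesz_decomposition {E : Type*} [AddCommGroup E] [Lattice E] [IsOrderedAddMonoid E]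
    {ι : Type*} (s : Finset ι) (v : ι → E) (hv : ∀ i, 0 ≤ v i)
    {x : E} (hx : 0 ≤ x) (hxv : x ≤ ∑ i ∈ s, v i) :
    ∃ w : ι → E, (∀ i, 0 ≤ w i ∧ w i ≤ v i) ∧ ∑ i ∈ s, w i = x := by
  classical
  induction s using Finset.induction_on generalizing x with
  | empty =>
    refine ⟨0, fun i => ⟨le_rfl, hv i⟩, ?_⟩
    rw [Finset.sum_empty] at hxv ⊢
    exact le_antisymm hx hxv
  | insert a s ha ih =>
    rw [Finset.sum_insert ha] at hxv
    have h1 : x - x ⊓ v a ≤ ∑ i ∈ s, v i := by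
      rw [sub_le_comm]
      refine le_inf ?_ (by rwa [sub_le_iff_le_add])
      exact sub_le_self _ (Finset.sum_nonneg fun i _ => hv i)
    obtain ⟨w, hw, hsum⟩ := ih (sub_nonneg.2 inf_le_left) h1
    refine ⟨Function.update w a (x ⊓ v a), fun i => ?_, ?_⟩
    · rcases eq_or_ne i a with rfl | hi
      · simpa using le_inf hx (hv _)
      · simpa [hi] using hw i
    · rw [Finset.sum_insert ha, Function.update_self,
        Finset.sum_congr rfl fun i hi => Function.update_of_ne (ne_of_mem_of_not_mem hi ha) _ _,
        hsum]
      abel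

theorem LinearMap.nonneg_of_le_posPart {E : Type*} [AddCommGroup E] [Lattice E] [Module ℝ E]
    {p : E → ℝ} (p0 : p 0 = 0) {f : E →ₗ[ℝ] ℝ}
    (hf : ∀ x, f x ≤ p x⁺) {x : E} (hx : -x ≤ 0) : 0 ≤ f x := by
  have := hf (-x)
  rw [show (-x)⁺ = 0 from sup_eq_right.2 hx, p0, map_neg] at this
  linarith

/-- Riesz decomposition property for positive linear functionals. -/
theorem exists_riesz_decomposition_dual {ι : Type*} [Fintype ι]
    (f : ι → E →ₗ[ℝ] ℝ) (hf : ∀ i x, 0 ≤ x → 0 ≤ f i x) {g : E →ₗ[ℝ] ℝ}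
    (hg : ∀ x, 0 ≤ x → 0 ≤ g x) (hgf : ∀ x, 0 ≤ x → g x ≤ ∑ i, f i x) :
    ∃ h : ι → E →ₗ[ℝ] ℝ, (∀ i x, 0 ≤ x → 0 ≤ h i x ∧ h i x ≤ f i x) ∧ ∑ i, h i = g := by
  classical
  rcases isEmpty_or_nonempty ι with hι | ⟨⟨i₀⟩⟩
  · refine ⟨f, fun i => hι.elim i, ?_⟩
    have g0 : ∀ x, 0 ≤ x → g x = 0 := fun x hx =>
      le_antisymm (by simpa using hgf x hx) (hg x hx)
    ext x
    have : g x = 0 := by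
      rw [← posPart_sub_negPart x, map_sub, g0 _ (posPart_nonneg x), g0 _ (negPart_nonneg x),
        sub_zero]
    simp [this]
  have f_mono : ∀ i x y, x ≤ y → f i x ≤ f i y := by
    intro i x y hxy
    have := hf i _ (sub_nonneg.2 hxy)
    rw [map_sub] at this
    linarith
  let D : (ι → E) →ₗ.[ℝ] ℝ :=
    ⟨LinearMap.range (LinearMap.pi fun _ : ι => (LinearMap.id : E →ₗ[ℝ] E)),
      (g ∘ₗ LinearMap.proj i₀).domRestrict _⟩
  obtain ⟨G, hG, hGp⟩ := exists_extension_of_le_sublinear D (fun z => ∑ i, f i (z i)⁺)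
    (by
      intro c hc z
      simp only [Pi.smul_apply, posPart_smul_of_pos hc, map_smul, smul_eq_mul, Finset.mul_sum])
    (by
      intro z w
      rw [← Finset.sum_add_distrib]
      refine Finset.sum_le_sum fun i _ => ?_
      rw [← map_add]
      exact f_mono i _ _ (posPart_add_le_add _ _))
    (by
      rintro ⟨_, x, rfl⟩
      have h1 : g x ≤ g x⁺ := by
        have := hg _ (sub_nonneg.2 (le_posPart x))
        rw [map_sub] at this
        linarith
      exact h1.trans (hgf _ (posPart_nonneg x)))
  have hle : ∀ i x, (G ∘ₗ LinearMap.single ℝ (fun _ => E) i) x ≤ f i x⁺ := by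
    intro i x
    refine (hGp _).trans_eq ?_
    rw [Finset.sum_eq_single i]
    · simp
    · intro j _ hj
      simp [hj]
    · simp
  refine ⟨fun i => G ∘ₗ LinearMap.single ℝ (fun _ => E) i, fun i x hx => ⟨?_, ?_⟩, ?_⟩
  · exact LinearMap.nonneg_of_le_posPart (map_zero (f i)) (hle i) (neg_nonpos.2 hx)
  · simpa [posPart_of_nonneg hx] using hle i x
  · ext x
    have h1 := hG ⟨_, x, rfl⟩
    have h2 : (fun _ : ι => x) = ∑ i, Pi.single i x := (Finset.univ_sum_single _).symm
    have h3 : G (fun _ => x) = g x := h1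
    rw [h2, map_sum] at h3
    simpa using h3

end NormedLattice

/-- `v` is a decomposition of `a` into positive elements. -/
def IsPositivePartition {E ι : Type*} [AddCommGroup E] [Lattice E] [Fintype ι]
    (v : ι → E) (a : E) : Prop :=
  (∀ i, 0 ≤ v i) ∧ ∑ i, v i = a

/-- `f` is a decomposition of `φ` into positive linear functionals. -/
def IsPositiveDualPartition {E κ : Type*} [AddCommGroup E] [Lattice E] [Module ℝ E] [Fintype κ]
    (f : κ → E →ₗ[ℝ] ℝ) (φ : E →ₗ[ℝ] ℝ) : Prop :=
  (∀ j x, 0 ≤ x → 0 ≤ f j x) ∧ ∑ j, f j = φ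

section Domination

variable {E : Type u} [NormedAddCommGroup E] [Lattice E] [HasSolidNorm E] [IsOrderedAddMonoid E]
  [NormedSpace ℝ E] {S K : E →L[ℝ] E}

theorem sum_partition_apply {E : Type*} [NormedAddCommGroup E] [Lattice E] [NormedSpace ℝ E]
    {ι κ : Type*} [Fintype ι] [Fintype κ] {v : ι → E}
    {f : κ → E →ₗ[ℝ] ℝ} {a : E} {φ : E →ₗ[ℝ] ℝ} (hv : IsPositivePartition v a)
    (hf : IsPositiveDualPartition f φ) (T : E →L[ℝ] E) :
    ∑ i, ∑ j, f j (T (v i)) = φ (T a) := by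
  rw [← hv.2, ← hf.2, map_sum, map_sum]
  simp [LinearMap.sum_apply]

theorem LinearMap.mono_of_nonneg {E : Type*} [AddCommGroup E] [Lattice E] [IsOrderedAddMonoid E]
    [Module ℝ E] {f : E →ₗ[ℝ] ℝ} (hf : ∀ x, 0 ≤ x → 0 ≤ f x) {x y : E}
    (h : x ≤ y) : f x ≤ f y := by
  have := hf _ (sub_nonneg.2 h)
  rw [map_sub] at this
  linarith

theorem relativeEnergy_le {E : Type*} [NormedAddCommGroup E] [Lattice E] [NormedSpace ℝ E]
    {S K : E →L[ℝ] E} {ι κ : Type*} [Fintype ι] [Fintype κ] {v : ι → E}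
    {f : κ → E →ₗ[ℝ] ℝ} {a : E} {φ : E →ₗ[ℝ] ℝ}
    (hcell : ∀ f : E →ₗ[ℝ] ℝ, (∀ x, 0 ≤ x → 0 ≤ f x) → ∀ x, 0 ≤ x →
      0 ≤ f (S x) ∧ f (S x) ≤ f (K x))
    (hv : IsPositivePartition v a) (hf : IsPositiveDualPartition f φ) :
    relativeEnergy S K v f ≤ φ (K a) := by
  rw [← sum_partition_apply hv hf]
  refine Finset.sum_le_sum fun i _ => Finset.sum_le_sum fun j _ => ?_
  obtain ⟨h0, h1⟩ := hcell (f j) (hf.1 j) (v i) (hv.1 i)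
  refine div_le_of_le_mul₀ (h0.trans h1) (h0.trans h1) ?_
  nlinarith

/-- Some pair of partitions has almost maximal energy. -/
theorem exists_relativeEnergy_almost_maximal {E : Type*} [NormedAddCommGroup E] [Lattice E]
    [NormedSpace ℝ E] {S K : E →L[ℝ] E} {a : E} (ha : 0 ≤ a) {φ : E →ₗ[ℝ] ℝ}
    (hφ : ∀ x, 0 ≤ x → 0 ≤ φ x)
    (hcell : ∀ f : E →ₗ[ℝ] ℝ, (∀ x, 0 ≤ x → 0 ≤ f x) → ∀ x, 0 ≤ x →
      0 ≤ f (S x) ∧ f (S x) ≤ f (K x)) {η : ℝ} (hη : 0 < η) :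
    ∃ (ι κ : Type) (_ : Fintype ι) (_ : Fintype κ) (v : ι → E) (f : κ → E →ₗ[ℝ] ℝ),
      IsPositivePartition v a ∧ IsPositiveDualPartition f φ ∧
      ∀ (ι' κ' : Type) [Fintype ι'] [Fintype κ'] (v' : ι' → E) (f' : κ' → E →ₗ[ℝ] ℝ),
        IsPositivePartition v' a → IsPositiveDualPartition f' φ →
          relativeEnergy S K v' f' ≤ relativeEnergy S K v f + η := by
  let A : Set ℝ := {r | ∃ (ι κ : Type) (_ : Fintype ι) (_ : Fintype κ) (v : ι → E)
    (f : κ → E →ₗ[ℝ] ℝ), IsPositivePartition v a ∧ IsPositiveDualPartition f φ ∧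
      relativeEnergy S K v f = r}
  have hne : A.Nonempty :=
    ⟨_, Unit, Unit, inferInstance, inferInstance, fun _ => a, fun _ => φ,
      ⟨fun _ => ha, by simp⟩, ⟨fun _ => hφ, by simp⟩, rfl⟩
  have hbdd : BddAbove A := by
    refine ⟨φ (K a), ?_⟩
    rintro _ ⟨ι, κ, _, _, v, f, hv, hf, rfl⟩
    exact relativeEnergy_le hcell hv hf
  obtain ⟨_, ⟨ι, κ, i1, i2, v, f, hv, hf, rfl⟩, hr⟩ :=
    exists_lt_of_lt_csSup hne (sub_lt_self (sSup A) hη)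
  refine ⟨ι, κ, i1, i2, v, f, hv, hf, fun ι' κ' _ _ v' f' hv' hf' => ?_⟩
  have : relativeEnergy S K v' f' ≤ sSup A :=
    le_csSup hbdd ⟨ι', κ', _, _, v', f', hv', hf', rfl⟩
  linarith

/-- If a pair of partitions has energy within `η` of the supremum, then on each cell `S` is close
to a multiple of `K`. -/
theorem sum_abs_sub_sq_le {E : Type*} [NormedAddCommGroup E] [Lattice E] [IsOrderedAddMonoid E]
    [NormedSpace ℝ E] {S K : E →L[ℝ] E} {ι κ : Type} [Fintype ι] [Fintype κ] {v : ι → E}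
    {f : κ → E →ₗ[ℝ] ℝ} {a : E} {φ : E →ₗ[ℝ] ℝ} {η : ℝ} (hη : 0 ≤ η)
    (hcell : ∀ f : E →ₗ[ℝ] ℝ, (∀ x, 0 ≤ x → 0 ≤ f x) → ∀ x, 0 ≤ x →
      0 ≤ f (S x) ∧ f (S x) ≤ f (K x))
    (hv : IsPositivePartition v a) (hf : IsPositiveDualPartition f φ)
    (hmax : ∀ (ι' κ' : Type) [Fintype ι'] [Fintype κ'] (v' : ι' → E) (f' : κ' → E →ₗ[ℝ] ℝ),
        IsPositivePartition v' a → IsPositiveDualPartition f' φ →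
          relativeEnergy S K v' f' ≤ relativeEnergy S K v f + η)
    {w : ι → E} (hw : ∀ i, 0 ≤ w i ∧ w i ≤ v i) {g : κ → E →ₗ[ℝ] ℝ}
    (hg : ∀ j x, 0 ≤ x → 0 ≤ g j x ∧ g j x ≤ f j x) :
    (∑ i, ∑ j, |g j (S (w i)) - f j (S (v i)) / f j (K (v i)) * g j (K (w i))|) ^ 2 ≤
      η * φ (K a) := by
  set t : ι → κ → ℝ :=
    fun i j => g j (S (w i)) - f j (S (v i)) / f j (K (v i)) * g j (K (w i)) with ht
  have hw' : ∀ i, 0 ≤ v i - w i := fun i => sub_nonneg.2 (hw i).2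
  have hgp : ∀ j x, 0 ≤ x → 0 ≤ g j x := fun j x hx => (hg j x hx).1
  have hg' : ∀ j x, 0 ≤ x → 0 ≤ (f j - g j) x := fun j x hx => by
    simpa using (hg j x hx).2
  let v' : ι × Bool → E := fun p => bif p.2 then w p.1 else v p.1 - w p.1
  let f' : κ × Bool → E →ₗ[ℝ] ℝ := fun p => bif p.2 then g p.1 else f p.1 - g p.1
  have hv' : IsPositivePartition v' a := by
    refine ⟨?_, ?_⟩
    · rintro ⟨i, _ | _⟩
      · exact hw' i
      · exact (hw i).1
    · rw [← hv.2, Fintype.sum_prod_type]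
      simp [v']
  have hf' : IsPositiveDualPartition f' φ := by
    refine ⟨?_, ?_⟩
    · rintro ⟨j, _ | _⟩
      · exact hg' j
      · exact hgp j
    · rw [← hf.2, Fintype.sum_prod_type]
      simp [f']
  have hbpos : ∀ i j, 0 ≤ g j (K (w i)) := fun i j =>
    let h := hcell (g j) (hgp j) (w i) (hw i).1
    h.1.trans h.2
  have hgain : relativeEnergy S K v f + ∑ i, ∑ j, (t i j) ^ 2 / g j (K (w i)) ≤
      relativeEnergy S K v' f' := by
    simp only [relativeEnergy, Fintype.sum_prod_type, Fintype.sum_bool, ← Finset.sum_add_distrib]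
    refine Finset.sum_le_sum fun i _ => Finset.sum_le_sum fun j _ => ?_
    have h00 := hcell (g j) (hgp j) (w i) (hw i).1
    have h01 := hcell (f j - g j) (hg' j) (w i) (hw i).1
    have h10 := hcell (g j) (hgp j) (v i - w i) (hw' i)
    have h11 := hcell (f j - g j) (hg' j) (v i - w i) (hw' i)
    have := sq_div_add_sq_div_le_of_split
      (a := ![g j (S (w i)), (f j - g j) (S (w i)), g j (S (v i - w i)),
        (f j - g j) (S (v i - w i))])
      (b := ![g j (K (w i)), (f j - g j) (K (w i)), g j (K (v i - w i)),
        (f j - g j) (K (v i - w i))])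
      (fun k => by fin_cases k <;> simp only [] <;>
        [exact h00.1; exact h01.1; exact h10.1; exact h11.1])
      (fun k => by fin_cases k <;> simp only [] <;>
        [exact h00.2; exact h01.2; exact h10.2; exact h11.2])
    have e : ∀ T : E →L[ℝ] E, g j (T (w i)) + (f j - g j) (T (w i)) + g j (T (v i - w i)) +
        (f j - g j) (T (v i - w i)) = f j (T (v i)) := by
      intro T
      simp only [LinearMap.sub_apply, map_sub]
      ring
    simp only [Fin.sum_univ_four, Matrix.cons_val, e] at this
    simp only [ht, v', f', cond_true, cond_false]
    linarith
  have hup := hmax _ _ v' f' hv' hf'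
  have hsq : ∑ p : ι × κ, (t p.1 p.2) ^ 2 / g p.2 (K (w p.1)) ≤ η := by
    rw [Fintype.sum_prod_type]
    linarith
  have hb : ∑ p : ι × κ, g p.2 (K (w p.1)) ≤ φ (K a) := by
    rw [Fintype.sum_prod_type, ← sum_partition_apply hv hf]
    refine Finset.sum_le_sum fun i _ => Finset.sum_le_sum fun j _ => ?_
    have h1 := hcell (f j - g j) (hg' j) (w i) (hw i).1
    have h2 := hcell (f j) (hf.1 j) (v i - w i) (hw' i)
    simp only [map_sub, LinearMap.sub_apply] at h1 h2
    linarith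
  rw [← Fintype.sum_prod_type' (f := fun i j => |t i j|)]
  refine (Finset.sum_sq_le_sum_mul_sum_of_sq_le_mul Finset.univ
    (f := fun p => (t p.1 p.2) ^ 2 / g p.2 (K (w p.1))) (g := fun p => g p.2 (K (w p.1)))
    (fun p _ => div_nonneg (sq_nonneg _) (hbpos _ _)) (fun p _ => hbpos _ _) ?_).trans ?_
  · rintro ⟨i, j⟩ -
    rw [sq_abs]
    rcases eq_or_ne (g j (K (w i))) 0 with h | h
    · have h00 := hcell (g j) (hgp j) (w i) (hw i).1
      have : g j (S (w i)) = 0 := le_antisymm (h ▸ h00.2) h00.1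
      simp [ht, h, this]
    · exact (div_mul_cancel₀ _ h).ge
  · exact mul_le_mul hsq hb (Finset.sum_nonneg fun p _ => hbpos _ _) hη

theorem IsCompactOperator.exists_finite_net {E : Type*} [NormedAddCommGroup E] [NormedSpace ℝ E]
    {K : E →L[ℝ] E} (hK : IsCompactOperator K) (R : ℝ) {ε : ℝ}
    (hε : 0 < ε) : ∃ t : Finset E, ∀ x, ‖x‖ ≤ R → ∃ y ∈ t, ‖K x - y‖ ≤ ε := by
  have hc : IsCompact (closure (K '' Metric.closedBall 0 R)) :=
    IsCompactOperator.isCompact_closure_image_closedBall (f := (K : E →ₗ[ℝ] E)) hK R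
  obtain ⟨t, ht, hsub⟩ := Metric.totallyBounded_iff.1 hc.totallyBounded ε hε
  refine ⟨ht.toFinset, fun x hx => ?_⟩
  have hx' : K x ∈ closure (K '' Metric.closedBall 0 R) :=
    subset_closure ⟨x, by simpa using hx, rfl⟩
  obtain ⟨y, hy, hxy⟩ := Set.mem_iUnion₂.1 (hsub hx')
  exact ⟨y, ht.mem_toFinset.2 hy, by simpa [dist_eq_norm] using (Metric.mem_ball.1 hxy).le⟩

theorem IsCompactOperator.finitelyDiscretizable {E : Type u} [NormedAddCommGroup E] [NormedSpace ℝ E]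
    {K : E →L[ℝ] E} (hK : IsCompactOperator K) (R : ℝ) :
    FinitelyDiscretizable (Metric.closedBall (0 : E) R) fun x y => ‖K x - K y‖ := by
  intro ε hε
  obtain ⟨t, ht⟩ := hK.exists_finite_net R (half_pos hε)
  choose! c hct hc using ht
  classical
  refine ⟨Option t, inferInstance, fun x => if h : c x ∈ t then some ⟨c x, h⟩ else none, ?_⟩
  intro x hx y hy hxy
  rw [mem_closedBall_zero_iff] at hx hy
  simp only [hct x hx, hct y hy, dite_true, Option.some.injEq, Subtype.mk.injEq] at hxy
  have h1 := hc x hx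
  have h2 := hc y hy
  rw [← hxy] at h2
  calc ‖K x - K y‖ = ‖(K x - c x) - (K y - c x)‖ := by rw [sub_sub_sub_cancel_right]
    _ ≤ ‖K x - c x‖ + ‖K y - c x‖ := norm_sub_le _ _
    _ ≤ ε := by linarith

theorem apply_abs_le_of_forall_dominated {φ : E →ₗ[ℝ] ℝ} (hφ : ∀ x, 0 ≤ x → 0 ≤ φ x) {y : E}
    {r : ℝ} (h : ∀ ψ : E →ₗ[ℝ] ℝ, (∀ x, 0 ≤ x → 0 ≤ ψ x ∧ ψ x ≤ φ x) → |ψ y| ≤ r) :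
    φ |y| ≤ 2 * r := by
  have key : ∀ z : E, ∃ ψ : E →ₗ[ℝ] ℝ, (∀ x, 0 ≤ x → 0 ≤ ψ x ∧ ψ x ≤ φ x) ∧ ψ z = φ z⁺ := by
    intro z
    obtain ⟨ψ, hψ, hle⟩ := exists_linear_le_sublinear (fun x : E => φ x⁺)
      (fun c hc x => by rw [posPart_smul_of_pos hc, map_smul, smul_eq_mul])
      (fun x y => by
        rw [← map_add]
        exact LinearMap.mono_of_nonneg hφ (posPart_add_le_add x y)) z
    refine ⟨ψ, fun x hx => ⟨?_, ?_⟩, hψ⟩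
    · exact LinearMap.nonneg_of_le_posPart (p := φ) (map_zero φ) hle (neg_nonpos.2 hx)
    · simpa [posPart_of_nonneg hx] using hle x
  obtain ⟨ψ₁, h₁, e₁⟩ := key y
  obtain ⟨ψ₂, h₂, e₂⟩ := key (-y)
  have a1 := (abs_le.1 (h ψ₁ h₁)).2
  have a2 := (abs_le.1 (h ψ₂ h₂)).1
  rw [map_neg, posPart_neg] at e₂
  rw [← posPart_add_negPart y, map_add]
  linarith

theorem LinearMap.abs_apply_le_of_dominated {E : Type*} [AddCommGroup E] [Lattice E]
    [IsOrderedAddMonoid E] [Module ℝ E] {ψ φ : E →ₗ[ℝ] ℝ}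
    (h : ∀ x, 0 ≤ x → 0 ≤ ψ x ∧ ψ x ≤ φ x) (x : E) : |ψ x| ≤ φ |x| := by
  have hψ : ∀ x, 0 ≤ x → 0 ≤ ψ x := fun x hx => (h x hx).1
  have h1 := LinearMap.mono_of_nonneg hψ (le_abs_self x)
  have h2 := LinearMap.mono_of_nonneg hψ (neg_le.1 (neg_le_abs x))
  have h3 := (h |x| (abs_nonneg x)).2
  rw [map_neg] at h2
  exact abs_le.2 ⟨by linarith, by linarith⟩

/-- A positive operator dominated by a compact operator maps order intervals to sets that are
totally bounded for the seminorm `φ |·|` of a bounded positive functional `φ`. -/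
theorem finitelyDiscretizable_Icc_functional (hS : ∀ x, 0 ≤ x → 0 ≤ S x)
    (hSK : ∀ x, 0 ≤ x → S x ≤ K x) (hK : IsCompactOperator K) {a : E} (ha : 0 ≤ a)
    {φ : E →ₗ[ℝ] ℝ} (hφ : ∀ x, 0 ≤ x → 0 ≤ φ x) {C : ℝ} (hC : 0 ≤ C)
    (hφC : ∀ x, φ x ≤ C * ‖x‖) :
    FinitelyDiscretizable (Set.Icc 0 a) fun x y => φ |S x - S y| := by
  intro ε hε
  have hcell : ∀ f : E →ₗ[ℝ] ℝ, (∀ x, 0 ≤ x → 0 ≤ f x) → ∀ x, 0 ≤ x →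
      0 ≤ f (S x) ∧ f (S x) ≤ f (K x) := fun f hf x hx =>
    ⟨hf _ (hS x hx), LinearMap.mono_of_nonneg hf (hSK x hx)⟩
  have hKa : 0 ≤ φ (K a) := hφ _ ((hS a ha).trans (hSK a ha))
  set δ : ℝ := ε / 8 with hδ
  have hδ0 : 0 < δ := by positivity
  set η : ℝ := δ ^ 2 / (φ (K a) + 1) with hη
  have hη0 : 0 < η := by positivity
  have hηδ : η * φ (K a) ≤ δ ^ 2 := by
    rw [hη, div_mul_eq_mul_div, div_le_iff₀ (by positivity)]
    nlinarith [sq_nonneg δ]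
  obtain ⟨ι, κ, _, _, v, f, hv, hf, hmax⟩ :=
    exists_relativeEnergy_almost_maximal ha hφ hcell hη0
  have hdec : ∀ x ∈ Set.Icc 0 a, ∃ w : ι → E, (∀ i, 0 ≤ w i ∧ w i ≤ v i) ∧ ∑ i, w i = x :=
    fun x hx => exists_riesz_decomposition Finset.univ v hv.1 hx.1 (hv.2 ▸ hx.2)
  choose! W hW hWsum using hdec
  set N : ℝ := Fintype.card ι * C + 1 with hN
  have hN0 : 0 < N := by positivity
  obtain ⟨α, _, c, hc⟩ := hK.finitelyDiscretizable ‖a‖ (ε / (4 * N)) (by positivity)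
  have hWball : ∀ x ∈ Set.Icc 0 a, ∀ i, W x i ∈ Metric.closedBall (0 : E) ‖a‖ := by
    intro x hx i
    rw [mem_closedBall_zero_iff]
    refine norm_le_norm_of_nonneg_of_le (hW x hx i).1 ((hW x hx i).2.trans ?_)
    rw [← hv.2]
    exact Finset.single_le_sum (fun i _ => hv.1 i) (Finset.mem_univ i)
  refine ⟨ι → α, inferInstance, fun x i => c (W x i), fun x hx y hy hxy => ?_⟩
  have hfin : φ |S x - S y| ≤ 2 * (ε / 2) := by
    refine apply_abs_le_of_forall_dominated hφ fun ψ hψ => ?_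
    obtain ⟨g, hg, hgsum⟩ := exists_riesz_decomposition_dual f hf.1 (fun x hx => (hψ x hx).1)
      (fun x hx => by
        have h := (hψ x hx).2
        rwa [← hf.2, LinearMap.sum_apply] at h)
    set h : ι → κ → ℝ := fun i j => f j (S (v i)) / f j (K (v i)) with hh
    have hh0 : ∀ i j, 0 ≤ h i j ∧ h i j ≤ 1 := fun i j =>
      let q := hcell (f j) (hf.1 j) (v i) (hv.1 i)
      ⟨div_nonneg q.1 (q.1.trans q.2), div_le_one_of_le₀ q.2 (q.1.trans q.2)⟩
    have happrox : ∀ z ∈ Set.Icc 0 a,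
        |ψ (S z) - ∑ i, ∑ j, h i j * g j (K (W z i))| ≤ δ := by
      intro z hz
      have h1 := sum_abs_sub_sq_le hη0.le hcell hv hf hmax (hW z hz) hg
      have h2 := abs_le_of_sq_le_sq (h1.trans hηδ) hδ0.le
      have h3 : ψ (S z) = ∑ i, ∑ j, g j (S (W z i)) := by
        conv_lhs => rw [← hgsum, ← hWsum z hz, map_sum, map_sum]
        simp [LinearMap.sum_apply]
      rw [h3, ← Finset.sum_sub_distrib]
      refine (Finset.abs_sum_le_sum_abs _ _).trans (le_trans ?_ ((le_abs_self _).trans h2))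
      refine Finset.sum_le_sum fun i _ => ?_
      rw [← Finset.sum_sub_distrib]
      exact Finset.abs_sum_le_sum_abs _ _
    have hmid : |∑ i, ∑ j, h i j * g j (K (W x i)) - ∑ i, ∑ j, h i j * g j (K (W y i))| ≤
        ε / 4 := by
      calc |∑ i, ∑ j, h i j * g j (K (W x i)) - ∑ i, ∑ j, h i j * g j (K (W y i))|
          = |∑ i, ∑ j, h i j * g j (K (W x i) - K (W y i))| := by
            simp only [map_sub, mul_sub, Finset.sum_sub_distrib]
        _ ≤ ∑ i, ∑ j, f j |K (W x i) - K (W y i)| := by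
            refine (Finset.abs_sum_le_sum_abs _ _).trans (Finset.sum_le_sum fun i _ => ?_)
            refine (Finset.abs_sum_le_sum_abs _ _).trans (Finset.sum_le_sum fun j _ => ?_)
            rw [abs_mul, abs_of_nonneg (hh0 i j).1]
            have := LinearMap.abs_apply_le_of_dominated (hg j) (K (W x i) - K (W y i))
            exact (mul_le_of_le_one_left (abs_nonneg _) (hh0 i j).2).trans this
        _ = ∑ i, φ |K (W x i) - K (W y i)| := by
            simp only [← hf.2, LinearMap.sum_apply]
        _ ≤ ∑ _i : ι, C * (ε / (4 * N)) := by
            refine Finset.sum_le_sum fun i _ => (hφC _).trans ?_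
            rw [norm_abs_eq_norm]
            exact mul_le_mul_of_nonneg_left
              (hc _ (hWball x hx i) _ (hWball y hy i) (congrFun hxy i)) hC
        _ = (N - 1) * (ε / (4 * N)) := by
            rw [Finset.sum_const, nsmul_eq_mul, Finset.card_univ, hN]
            ring
        _ ≤ N * (ε / (4 * N)) := by
            gcongr
            linarith
        _ = ε / 4 := by field_simp
    have hx' := abs_le.1 (happrox x hx)
    have hy' := abs_le.1 (happrox y hy)
    have hm' := abs_le.1 hmid
    rw [map_sub, abs_le]
    constructor <;> linarith [hx'.1, hx'.2, hy'.1, hy'.2, hm'.1, hm'.2]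
  linarith

/-- A compact operator is, up to `ε` on bounded sets of positive elements, dominated in norm by a
bounded positive functional. -/
theorem IsCompactOperator.exists_functional_norm_le (hKpos : ∀ x, 0 ≤ x → 0 ≤ K x)
    (hK : IsCompactOperator K) (R : ℝ) {ε : ℝ} (hε : 0 < ε) :
    ∃ (φ : E →ₗ[ℝ] ℝ) (C : ℝ), (∀ x, 0 ≤ x → 0 ≤ φ x) ∧ 0 ≤ C ∧ (∀ x, φ x ≤ C * ‖x‖) ∧
      ∀ x, 0 ≤ x → ‖x‖ ≤ R → ‖K x‖ ≤ φ x + ε := by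
  obtain ⟨t, ht⟩ := hK.exists_finite_net R (half_pos hε)
  have key : ∀ y : E, ∃ f : E →ₗ[ℝ] ℝ, f y = ‖y⁺‖ ∧ ∀ x, f x ≤ ‖x⁺‖ := fun y =>
    exists_linear_le_sublinear (fun x : E => ‖x⁺‖)
      (fun c hc x => by rw [posPart_smul_of_pos hc, norm_smul, Real.norm_of_nonneg hc.le])
      (fun x y => (norm_le_norm_of_nonneg_of_le (posPart_nonneg _)
        (posPart_add_le_add x y)).trans (norm_add_le _ _)) y
  choose f hfy hf using key
  have hfpos : ∀ y x, 0 ≤ x → 0 ≤ f y x := fun y x hx =>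
    LinearMap.nonneg_of_le_posPart (p := norm) norm_zero (hf y) (neg_nonpos.2 hx)
  have happ : ∀ x, (∑ y ∈ t, f y ∘ₗ (K : E →ₗ[ℝ] E)) x = ∑ y ∈ t, f y (K x) := by
    intro x
    simp [LinearMap.sum_apply]
  refine ⟨∑ y ∈ t, f y ∘ₗ (K : E →ₗ[ℝ] E), t.card * ‖K‖, ?_, by positivity, ?_, ?_⟩
  · intro x hx
    rw [happ]
    exact Finset.sum_nonneg fun y _ => hfpos y _ (hKpos x hx)
  · intro x
    rw [happ, mul_assoc, ← nsmul_eq_mul]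
    exact Finset.sum_le_card_nsmul _ _ _ fun y _ =>
      (hf y _).trans ((norm_posPart_le_norm _).trans (K.le_opNorm x))
  · intro x hx hxR
    obtain ⟨y, hy, hxy⟩ := ht x hxR
    rw [happ]
    have h1 : f y (K x) ≤ ∑ y ∈ t, f y (K x) :=
      Finset.single_le_sum (f := fun y => f y (K x)) (fun y _ => hfpos y _ (hKpos x hx)) hy
    have h2 : ‖K x‖ ≤ ‖y⁺‖ + ‖K x - y‖ := by
      have h3 : K x ≤ y⁺ + (K x - y)⁺ := by
        simpa using (le_posPart _).trans (posPart_add_le_add y (K x - y))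
      calc ‖K x‖ ≤ ‖y⁺ + (K x - y)⁺‖ :=
            norm_le_norm_of_nonneg_of_le (hKpos x hx) h3
        _ ≤ ‖y⁺‖ + ‖(K x - y)⁺‖ := norm_add_le _ _
        _ ≤ _ := by gcongr; exact norm_posPart_le_norm _
    have h5 : f y y ≤ f y (K x) + ‖K x - y‖ := by
      have := (hf y (y - K x)).trans (norm_posPart_le_norm _)
      rw [map_sub, norm_sub_rev] at this
      linarith
    rw [hfy] at h5
    linarith

/-- An operator dominated by a compact operator maps positive elements of a ball below a fixed
element, up to `ε`. -/
theorem IsCompactOperator.exists_norm_sub_inf_le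
    (hSK : ∀ x, 0 ≤ x → S x ≤ K x) (hK : IsCompactOperator K) (R : ℝ) {ε : ℝ} (hε : 0 < ε) :
    ∃ a : E, 0 ≤ a ∧ ∀ x, 0 ≤ x → ‖x‖ ≤ R → ‖S x - S x ⊓ a‖ ≤ ε := by
  obtain ⟨t, ht⟩ := hK.exists_finite_net R hε
  refine ⟨∑ y ∈ t, |y|, Finset.sum_nonneg fun y _ => abs_nonneg y, fun x hx hxR => ?_⟩
  obtain ⟨y, hy, hxy⟩ := ht x hxR
  refine le_trans (norm_le_norm_of_abs_le_abs ?_) hxy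
  rw [abs_of_nonneg (sub_nonneg.2 inf_le_left), sub_le_comm]
  refine le_inf (sub_le_self _ (abs_nonneg _)) ?_
  have h1 : |y| ≤ ∑ y ∈ t, |y| :=
    Finset.single_le_sum (f := fun y : E => |y|) (fun y _ => abs_nonneg y) hy
  have h2 : S x ≤ y + |K x - y| := by
    have := add_le_add_right (le_abs_self (K x - y)) y
    rw [add_sub_cancel] at this
    exact (hSK x hx).trans this
  rw [sub_le_iff_le_add]
  exact h2.trans (by gcongr; exact (le_abs_self y).trans h1)

/-- A positive operator `S` dominated by a compact operator is such that `S ∘ S` maps order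
intervals to totally bounded sets. -/
theorem finitelyDiscretizable_Icc_comp (hS : ∀ x, 0 ≤ x → 0 ≤ S x)
    (hSK : ∀ x, 0 ≤ x → S x ≤ K x) (hK : IsCompactOperator K) {a : E} (ha : 0 ≤ a) :
    FinitelyDiscretizable (Set.Icc 0 a) fun x y => ‖S (S x) - S (S y)‖ := by
  intro ε hε
  have hKpos : ∀ x, 0 ≤ x → 0 ≤ K x := fun x hx => (hS x hx).trans (hSK x hx)
  obtain ⟨φ, C, hφ, hC, hφC, hφK⟩ :=
    hK.exists_functional_norm_le hKpos (‖S a‖) (half_pos hε)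
  obtain ⟨α, hα, c, hc⟩ :=
    finitelyDiscretizable_Icc_functional hS hSK hK ha hφ hC hφC (ε / 2) (half_pos hε)
  refine ⟨α, hα, c, fun x hx y hy hxy => ?_⟩
  have h1 := hc x hx y hy hxy
  have mono : ∀ {x y : E}, x ≤ y → S x ≤ S y := by
    intro x y h
    have := hS _ (sub_nonneg.2 h)
    rwa [map_sub, sub_nonneg] at this
  have h2 : ‖|S x - S y|‖ ≤ ‖S a‖ := by
    refine norm_le_norm_of_nonneg_of_le (abs_nonneg _) (abs_le'.2 ⟨?_, ?_⟩)
    · exact (sub_le_self _ (hS y hy.1)).trans (mono hx.2)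
    · rw [neg_sub]
      exact (sub_le_self _ (hS x hx.1)).trans (mono hy.2)
  have h3 : |S (S x - S y)| ≤ K |S x - S y| := by
    refine le_trans (abs_le'.2 ⟨mono (le_abs_self _), ?_⟩) (hSK _ (abs_nonneg _))
    rw [← map_neg]
    exact mono (neg_le_abs _)
  calc ‖S (S x) - S (S y)‖ = ‖|S (S x - S y)|‖ := by rw [norm_abs_eq_norm, map_sub]
    _ ≤ ‖K |S x - S y|‖ := norm_le_norm_of_nonneg_of_le (abs_nonneg _) h3
    _ ≤ φ |S x - S y| + ε / 2 := hφK _ (abs_nonneg _) h2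
    _ ≤ ε := by linarith

/-- **Aliprantis–Burkinshaw theorem**: the cube of a positive operator dominated by a compact
operator is compact. -/
theorem isCompactOperator_pow_three_of_dominated [CompleteSpace E]
    (hS : ∀ x, 0 ≤ x → 0 ≤ S x) (hSK : ∀ x, 0 ≤ x → S x ≤ K x) (hK : IsCompactOperator K) :
    IsCompactOperator ⇑(S ^ 3) := by
  have hcube : ∀ x, (S ^ 3) x = S (S (S x)) := fun x => by simp [pow_succ]
  suffices h : TotallyBounded (⇑(S ^ 3) '' Metric.closedBall (0 : E) 1) by
    exact (isCompactOperator_iff_isCompact_closure_image_closedBall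
      ((S ^ 3 : E →L[ℝ] E) : E →ₗ[ℝ] E) one_pos).2
      (TotallyBounded.isCompact_of_isClosed h.closure isClosed_closure)
  have hpos : FinitelyDiscretizable {x : E | 0 ≤ x ∧ ‖x‖ ≤ 1}
      fun x y => ‖(S ^ 3) x - (S ^ 3) y‖ := by
    intro ε hε
    set M : ℝ := ‖S‖ * ‖S‖ + 1 with hM
    have hM0 : 0 < M := by positivity
    obtain ⟨a, ha, haS⟩ :=
      hK.exists_norm_sub_inf_le hSK 1 (ε := ε / (4 * M)) (by positivity)
    obtain ⟨α, hα, c, hc⟩ := finitelyDiscretizable_Icc_comp hS hSK hK ha (ε / 2) (half_pos hε)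
    refine ⟨α, hα, fun x => c (S x ⊓ a), fun x hx y hy hxy => ?_⟩
    have hmem : ∀ z : E, 0 ≤ z → S z ⊓ a ∈ Set.Icc 0 a := fun z hz =>
      ⟨le_inf (hS z hz) ha, inf_le_right⟩
    have h1 := hc _ (hmem x hx.1) _ (hmem y hy.1) hxy
    beta_reduce at h1 ⊢
    have h2 : ∀ z : E, 0 ≤ z → ‖z‖ ≤ 1 → ‖S (S (S z)) - S (S (S z ⊓ a))‖ ≤ ε / 4 := by
      intro z hz hz1
      rw [← map_sub, ← map_sub]
      calc ‖S (S (S z - S z ⊓ a))‖ ≤ ‖S‖ * (‖S‖ * ‖S z - S z ⊓ a‖) :=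
            (S.le_opNorm _).trans (by gcongr; exact S.le_opNorm _)
        _ ≤ ‖S‖ * (‖S‖ * (ε / (4 * M))) := by gcongr; exact haS z hz hz1
        _ = (M - 1) * (ε / (4 * M)) := by rw [hM]; ring
        _ ≤ M * (ε / (4 * M)) := by gcongr; linarith
        _ = ε / 4 := by field_simp
    have hx2 := h2 x hx.1 hx.2
    have hy2 := h2 y hy.1 hy.2
    rw [hcube, hcube]
    set p := S (S (S x))
    set q := S (S (S y))
    set p' := S (S (S x ⊓ a))
    set q' := S (S (S y ⊓ a))
    calc ‖p - q‖ = ‖(p - p') + (p' - q') - (q - q')‖ := by congr 1; abel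
      _ ≤ ‖p - p'‖ + ‖p' - q'‖ + ‖q - q'‖ :=
        (norm_sub_le _ _).trans (by gcongr; exact norm_add_le _ _)
      _ ≤ ε := by linarith
  refine Metric.totallyBounded_of_finite_discretization fun ε hε => ?_
  obtain ⟨α, _, c, hc⟩ := hpos (ε / 3) (by positivity)
  have hmem : ∀ z : E, ‖z‖ ≤ 1 → z⁺ ∈ {x : E | 0 ≤ x ∧ ‖x‖ ≤ 1} := fun z hz =>
    ⟨posPart_nonneg z, (norm_posPart_le_norm z).trans hz⟩
  have hpre : ∀ y : ⇑(S ^ 3) '' Metric.closedBall (0 : E) 1, ∃ x : E, ‖x‖ ≤ 1 ∧ (S ^ 3) x = y := by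
    rintro ⟨_, x, hx, rfl⟩
    exact ⟨x, mem_closedBall_zero_iff.1 hx, rfl⟩
  choose r hr hrS using hpre
  refine ⟨α × α, Fintype.ofFinite _, fun y => (c (r y)⁺, c (-r y)⁺), fun y z hyz => ?_⟩
  have h1 := hc _ (hmem _ (hr y)) _ (hmem _ (hr z)) (congrArg Prod.fst hyz)
  have h2 := hc _ (hmem _ ((norm_neg (r y)).trans_le (hr y))) _
    (hmem _ ((norm_neg (r z)).trans_le (hr z))) (congrArg Prod.snd hyz)
  simp only [posPart_neg] at h2
  rw [dist_eq_norm, ← hrS y, ← hrS z]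
  have e : ∀ x : E, (S ^ 3) x = (S ^ 3) x⁺ - (S ^ 3) x⁻ := fun x => by
    rw [← map_sub, posPart_sub_negPart]
  rw [e (r y), e (r z), sub_sub_sub_comm]
  exact (norm_sub_le _ _).trans_lt (by linarith)

end Domination

/-- If `A B ≥ B A ≥ 0` on a Banach lattice `E` and `A B` is power-compact,
then both `B A` and the commutator `C = A B - B A` are power-compact. -/
theorem stmt10 {E : Type*} [NormedAddCommGroup E] [Lattice E] [HasSolidNorm E] [IsOrderedAddMonoid E] [NormedSpace ℝ E] [CompleteSpace E]
    (A B : E →L[ℝ] E)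
    (hBA : ∀ x : E, 0 ≤ x → 0 ≤ (B * A) x)
    (hC : ∀ x : E, 0 ≤ x → 0 ≤ (A * B - B * A) x)
    (hAB : ∃ n : ℕ, 1 ≤ n ∧ IsCompactOperator ⇑((A * B) ^ n)) :
    (∃ n : ℕ, 1 ≤ n ∧ IsCompactOperator ⇑((B * A) ^ n)) ∧
    (∃ n : ℕ, 1 ≤ n ∧ IsCompactOperator ⇑((A * B - B * A) ^ n)) := by
  obtain ⟨n, hn, hcpt⟩ := hAB
  refine ⟨⟨n + 1, Nat.le_add_left 1 n, ?_⟩, ⟨n * 3, by lia, ?_⟩⟩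
  · have hfac : ∀ m : ℕ, (B * A) ^ (m + 1) = B * (A * B) ^ m * A := by
      intro m
      induction m with
      | zero => simp
      | succ m ih =>
        rw [pow_succ, ih, pow_succ (A * B)]
        simp only [mul_assoc]
    rw [hfac]
    exact (hcpt.clm_comp B).comp_clm A
  · have mono : ∀ {x y : E}, x ≤ y → (A * B - B * A) x ≤ (A * B - B * A) y := by
      intro x y h
      have := hC _ (sub_nonneg.2 h)
      rwa [map_sub, sub_nonneg] at this
    have hle : ∀ x : E, 0 ≤ x → (A * B - B * A) x ≤ (A * B) x := fun x hx => by
      simpa using hBA x hx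
    have hpow : ∀ (m : ℕ) (x : E), 0 ≤ x →
        0 ≤ ((A * B - B * A) ^ m) x ∧ ((A * B - B * A) ^ m) x ≤ ((A * B) ^ m) x := by
      intro m
      induction m with
      | zero => exact fun x hx => ⟨by simpa using hx, by simp⟩
      | succ m ih =>
        intro x hx
        obtain ⟨h0, h1⟩ := ih x hx
        rw [pow_succ', pow_succ']
        exact ⟨hC _ h0, (mono h1).trans (hle _ (h0.trans h1))⟩
    rw [pow_mul]
    exact isCompactOperator_pow_three_of_dominated (fun x hx => (hpow n x hx).1)
      (fun x hx => (hpow n x hx).2) hcpt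
end
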